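/- arXiv:1505.04215 — 10 statements merged into one kernel-verified Lean document; each statement's English description precedes it below -/
import Mathlib

section
/- Let (Ω, 𝒜) be a measurable space and let P₀, P₁ be probability measures on Ω such that the Kullback–Leibler divergence satisfies KL(P₁ ‖ P₀) ≤ γ for some real γ ≥ 0 (in particular P₁ is absolutely continuous with respect to P₀). Let (F, d) be a pseudometric space equipped with its Borel σ-algebra, let f₀, f₁ ∈ F satisfy d(f₀, f₁) ≥ 2a for some a > 0, and let f̂ : Ω → F be measurable. Then max_{j∈{0,1}} P_j( {ω : d(f̂(ω), f_j) ≥ a} ) ≥ max( e^{−γ}/4, (1 − √(γ/2))/2 ). -/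
open MeasureTheory Real
open scoped ENNReal Classical

/-- Kullback–Leibler divergence between measures: `∫ log (dP/dQ) dP` when `P ≪ Q`
(and the integrand is `P`-integrable), and `+∞` otherwise. -/
noncomputable def KLdiv {Ω : Type*} [MeasurableSpace Ω] (P Q : Measure Ω) : ℝ≥0∞ :=
  if P ≪ Q ∧ Integrable (fun ω => Real.log (P.rnDeriv Q ω).toReal) P then
    ENNReal.ofReal (∫ ω, Real.log (P.rnDeriv Q ω).toReal ∂P)
  else ⊤

lemma integrable_exp_mul_indicator_one {Ω : Type*} [MeasurableSpace Ω] {ν : Measure Ω}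
    [IsProbabilityMeasure ν] {A : Set Ω} (hA : MeasurableSet A) (s : ℝ) :
    Integrable (fun ω ↦ Real.exp (s * A.indicator (1 : Ω → ℝ) ω)) ν := by
  refine ProbabilityTheory.integrable_exp_mul_of_mem_Icc (a := 0) (b := 1)
    ((measurable_one.indicator hA).aemeasurable) (ae_of_all _ fun ω ↦ ?_)
  by_cases h : ω ∈ A <;> simp [h]

/-- **Donsker–Varadhan inequality** for a multiple of an indicator function. -/
lemma mul_measureReal_sub_log_le_integral_llr {Ω : Type*} [MeasurableSpace Ω] {μ ν : Measure Ω}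
    [IsProbabilityMeasure μ] [IsProbabilityMeasure ν] (hμν : μ ≪ ν)
    (h_int : Integrable (llr μ ν) μ) {A : Set Ω} (hA : MeasurableSet A) (s : ℝ) :
    s * μ.real A - Real.log (∫ ω, Real.exp (s * A.indicator 1 ω) ∂ν) ≤ ∫ ω, llr μ ν ω ∂μ := by
  have hf_int : Integrable (fun ω ↦ s * A.indicator (1 : Ω → ℝ) ω) μ :=
    ((integrable_const (1 : ℝ)).indicator hA).const_mul s
  have hexp_int := integrable_exp_mul_indicator_one (ν := ν) hA s
  have := isProbabilityMeasure_tilted hexp_int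
  have hgibbs := InformationTheory.integral_llr_add_sub_measure_univ_nonneg
    (hμν.trans (absolutelyContinuous_tilted hexp_int))
    (integrable_llr_tilted_right hμν hf_int h_int hexp_int)
  rw [integral_llr_tilted_right hμν hf_int hexp_int h_int, integral_const_mul,
    integral_indicator_one hA, probReal_univ, probReal_univ] at hgibbs
  linarith

lemma integral_exp_mul_indicator_one {Ω : Type*} [MeasurableSpace Ω] {ν : Measure Ω}
    [IsProbabilityMeasure ν] {A : Set Ω} (hA : MeasurableSet A) (s : ℝ) :
    ∫ ω, Real.exp (s * A.indicator 1 ω) ∂ν = 1 + (Real.exp s - 1) * ν.real A := by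
  have h : (fun ω ↦ Real.exp (s * A.indicator (1 : Ω → ℝ) ω)) =
      fun ω ↦ 1 + (Real.exp s - 1) * A.indicator (1 : Ω → ℝ) ω := by
    ext ω
    by_cases h : ω ∈ A <;> simp [h]
  have hA_int : Integrable (A.indicator (1 : Ω → ℝ)) ν := (integrable_const (1 : ℝ)).indicator hA
  rw [h, integral_add (integrable_const _) (hA_int.const_mul _), integral_const_mul,
    integral_indicator_one hA]
  simp

/-- **Hoeffding's lemma** for the indicator function of an event. -/
lemma log_integral_exp_mul_indicator_one_le {Ω : Type*} [MeasurableSpace Ω] {ν : Measure Ω}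
    [IsProbabilityMeasure ν] {A : Set Ω} (hA : MeasurableSet A) (s : ℝ) :
    Real.log (∫ ω, Real.exp (s * A.indicator 1 ω) ∂ν) ≤ s * ν.real A + s ^ 2 / 8 := by
  have hexp_int := integrable_exp_mul_indicator_one (ν := ν) hA s
  have hsub := ProbabilityTheory.hasSubgaussianMGF_of_mem_Icc (μ := ν) (a := 0) (b := 1)
    (X := A.indicator 1) ((measurable_one.indicator hA).aemeasurable)
    (ae_of_all _ fun ω ↦ by by_cases h : ω ∈ A <;> simp [h])
  have hmgf := hsub.mgf_le s
  rw [integral_indicator_one hA] at hmgf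
  simp only [ProbabilityTheory.mgf, mul_sub, Real.exp_sub, integral_div] at hmgf
  rw [div_le_iff₀ (Real.exp_pos _), ← Real.exp_add] at hmgf
  refine (Real.log_le_iff_le_exp (integral_exp_pos hexp_int)).2 (hmgf.trans_eq ?_)
  congr 1
  norm_num
  ring

lemma neg_mul_log_le_log_two {m : ℝ} (hm : 0 < m) : -(m * Real.log m) ≤ Real.log 2 := by
  have h : Real.log (1 / (2 * m)) ≤ 1 / (2 * m) - 1 := Real.log_le_sub_one_of_pos (by positivity)
  rw [Real.log_div one_ne_zero (by positivity), Real.log_one,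
    Real.log_mul two_ne_zero hm.ne'] at h
  have h' := mul_le_mul_of_nonneg_left h hm.le
  have hm' : m * (1 / (2 * m) - 1) = 1 / 2 - m := by field_simp
  nlinarith [Real.log_two_gt_d9, Real.log_two_lt_d9]

/-- The Pinsker-type bound on the sum of the two error probabilities of a test. -/
lemma one_sub_sqrt_le_measureReal_add_measureReal_compl {Ω : Type*} [MeasurableSpace Ω]
    {μ ν : Measure Ω} [IsProbabilityMeasure μ] [IsProbabilityMeasure ν] (hμν : μ ≪ ν)
    (h_int : Integrable (llr μ ν) μ) {γ : ℝ} (hγ : ∫ ω, llr μ ν ω ∂μ ≤ γ)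
    {A : Set Ω} (hA : MeasurableSet A) :
    1 - Real.sqrt (γ / 2) ≤ ν.real A + μ.real Aᶜ := by
  have hDV := mul_measureReal_sub_log_le_integral_llr hμν h_int hA (4 * (μ.real A - ν.real A))
  have hHoeffding := log_integral_exp_mul_indicator_one_le (ν := ν) hA
    (4 * (μ.real A - ν.real A))
  have h : μ.real A - ν.real A ≤ Real.sqrt (γ / 2) :=
    Real.le_sqrt_of_sq_le (by linarith)
  rw [probReal_compl_eq_one_sub hA]
  linarith

/-- The Bretagnolle–Huber-type bound on the larger of the two error probabilities of a test. -/
lemma exp_neg_div_four_le_max_measureReal {Ω : Type*} [MeasurableSpace Ω]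
    {μ ν : Measure Ω} [IsProbabilityMeasure μ] [IsProbabilityMeasure ν] (hμν : μ ≪ ν)
    (h_int : Integrable (llr μ ν) μ) {γ : ℝ} (hγ₀ : 0 ≤ γ) (hγ : ∫ ω, llr μ ν ω ∂μ ≤ γ)
    {A : Set Ω} (hA : MeasurableSet A) :
    Real.exp (-γ) / 4 ≤ max (ν.real A) (μ.real Aᶜ) := by
  by_contra! hlt
  obtain ⟨hν, hμ⟩ := max_lt_iff.1 hlt
  rw [probReal_compl_eq_one_sub hA] at hμ
  set m := Real.exp (-γ) / 4 with hm
  have hm_pos : 0 < m := by positivity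
  have hlog : Real.log m = -γ - 2 * Real.log 2 := by
    rw [hm, Real.log_div (Real.exp_pos _).ne' (by norm_num), Real.log_exp,
      show (4 : ℝ) = 2 ^ 2 by norm_num, Real.log_pow]
    norm_num
  have hlog_two := Real.log_pos one_lt_two
  have hDV := mul_measureReal_sub_log_le_integral_llr hμν h_int hA (-Real.log m)
  rw [integral_exp_mul_indicator_one hA, Real.exp_neg, Real.exp_log hm_pos] at hDV
  have hν₀ : 0 ≤ ν.real A := measureReal_nonneg
  have hνm : m⁻¹ * ν.real A ≤ 1 := by
    rw [inv_mul_le_iff₀ hm_pos]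
    linarith
  have hZ : Real.log (1 + (m⁻¹ - 1) * ν.real A) ≤ Real.log 2 := by
    refine Real.log_le_log ?_ (by linarith)
    have : 0 ≤ m⁻¹ * ν.real A := by positivity
    have : ν.real A < 1 := by
      have : Real.exp (-γ) ≤ 1 := Real.exp_le_one_iff.2 (by linarith)
      linarith
    linarith
  have hmlog := neg_mul_log_le_log_two hm_pos
  have hprod : 0 < (m - (1 - μ.real A)) * (-Real.log m) :=
    mul_pos (by linarith) (by linarith)
  linarith

/-- Tsybakov's two-point lower bound (probability version): if `KL(P₁ ‖ P₀) ≤ γ` and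
`d(f₀, f₁) ≥ 2a` with `a > 0`, then for any measurable estimator `f̂`,
`max_j P_j(d(f̂, f_j) ≥ a) ≥ max(e^{-γ}/4, (1 - √(γ/2))/2)`. -/
theorem two_point_lower_bound_prob
    {Ω : Type*} [MeasurableSpace Ω] (P₀ P₁ : Measure Ω)
    [IsProbabilityMeasure P₀] [IsProbabilityMeasure P₁]
    {γ : ℝ} (hγ : 0 ≤ γ) (hKL : KLdiv P₁ P₀ ≤ ENNReal.ofReal γ)
    {F : Type*} [PseudoMetricSpace F] [MeasurableSpace F] [BorelSpace F]
    (f₀ f₁ : F) {a : ℝ} (ha : 0 < a) (hd : dist f₀ f₁ ≥ 2 * a)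
    (fhat : Ω → F) (hfhat : Measurable fhat) :
    max (P₀ {ω | dist (fhat ω) f₀ ≥ a}).toReal (P₁ {ω | dist (fhat ω) f₁ ≥ a}).toReal ≥
      max (Real.exp (-γ) / 4) ((1 - Real.sqrt (γ / 2)) / 2) := by
  obtain ⟨hac, h_int⟩ : P₁ ≪ P₀ ∧ Integrable (llr P₁ P₀) P₁ := by
    by_contra h
    have htop : KLdiv P₁ P₀ = ⊤ := if_neg h
    simp [htop] at hKL
  have hle : ∫ ω, llr P₁ P₀ ω ∂P₁ ≤ γ := by
    have heq : KLdiv P₁ P₀ = ENNReal.ofReal (∫ ω, llr P₁ P₀ ω ∂P₁) := if_pos ⟨hac, h_int⟩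
    rwa [heq, ENNReal.ofReal_le_ofReal_iff hγ] at hKL
  set A := {ω | dist (fhat ω) f₀ ≥ a} with hA_def
  have hA : MeasurableSet A :=
    hfhat (isClosed_le continuous_const (continuous_id.dist continuous_const)).measurableSet
  have hsub : Aᶜ ⊆ {ω | dist (fhat ω) f₁ ≥ a} := by
    intro ω hω
    simp only [hA_def, Set.mem_compl_iff, Set.mem_ofPred_eq, ge_iff_le, not_le] at hω ⊢
    have := dist_triangle_left f₀ f₁ (fhat ω)
    linarith
  have hmono : P₁.real Aᶜ ≤ P₁.real {ω | dist (fhat ω) f₁ ≥ a} := measureReal_mono hsub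
  refine le_trans (max_le (exp_neg_div_four_le_max_measureReal hac h_int hγ hle hA) ?_)
    (max_le_max le_rfl hmono)
  have hsum := one_sub_sqrt_le_measureReal_add_measureReal_compl hac h_int hle hA
  have := le_max_left (P₀.real A) (P₁.real Aᶜ)
  have := le_max_right (P₀.real A) (P₁.real Aᶜ)
  linarith
end

section
/- Let (Ω, 𝒜) be a measurable space and let P₀, P₁ be probability measures on Ω such that the Kullback–Leibler divergence satisfies KL(P₁ ‖ P₀) ≤ γ for some real γ ≥ 0 (in particular P₁ is absolutely continuous with respect to P₀). Let (F, d) be a pseudometric space equipped with its Borel σ-algebra, let f₀, f₁ ∈ F satisfy d(f₀, f₁) ≥ 2a for some a > 0, and let f̂ : Ω → F be measurable. Then max_{j∈{0,1}} E_{P_j}[ d(f̂, f_j) ] ≥ a · max( e^{−γ}/4, (1 − √(γ/2))/2 ). -/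
open MeasureTheory Real
open scoped ENNReal Classical

open InformationTheory ProbabilityTheory

lemma mul_sub_exp_le_klFun {x : ℝ} (hx : 0 ≤ x) (t : ℝ) :
    x * t - Real.exp t + 1 ≤ klFun x := by
  rw [klFun_apply]
  rcases hx.eq_or_lt with rfl | hx
  · simp [(Real.exp_pos t).le]
  · have h := Real.log_le_sub_one_of_pos (div_pos (Real.exp_pos t) hx)
    rw [Real.log_div (Real.exp_ne_zero t) hx.ne', Real.log_exp] at h
    have h' := mul_le_mul_of_nonneg_left h hx.le
    have : x * (Real.exp t / x - 1) = Real.exp t - x := by field_simp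
    linarith

section

variable {Ω : Type*} [MeasurableSpace Ω] {P₀ P₁ : Measure Ω}
  [IsProbabilityMeasure P₀] [IsProbabilityMeasure P₁] {γ : ℝ}

/-- Donsker–Varadhan (Fenchel) lower bound for the Kullback–Leibler divergence. -/
lemma integral_sub_integral_exp_le_of_KLdiv_le (hγ : 0 ≤ γ)
    (hKL : KLdiv P₁ P₀ ≤ ENNReal.ofReal γ) {g : Ω → ℝ} (hg₁ : Integrable g P₁)
    (hg₀ : Integrable (fun ω => Real.exp (g ω)) P₀) :
    ∫ ω, g ω ∂P₁ - ∫ ω, Real.exp (g ω) ∂P₀ + 1 ≤ γ := by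
  unfold KLdiv at hKL
  split_ifs at hKL with h
  · obtain ⟨hac, hint⟩ := h
    replace hKL := (ENNReal.ofReal_le_ofReal_iff hγ).1 hKL
    have hkl : ∫ ω, klFun (P₁.rnDeriv P₀ ω).toReal ∂P₀ =
        ∫ ω, Real.log (P₁.rnDeriv P₀ ω).toReal ∂P₁ := by
      rw [integral_klFun_rnDeriv hac hint]
      simp [llr]
    have hmul : Integrable (fun ω => (P₁.rnDeriv P₀ ω).toReal * g ω) P₀ :=
      (integrable_rnDeriv_smul_iff hac).2 hg₁
    have hsub : Integrable (fun ω => (P₁.rnDeriv P₀ ω).toReal * g ω - Real.exp (g ω)) P₀ :=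
      hmul.sub hg₀
    have hmono : ∫ ω, ((P₁.rnDeriv P₀ ω).toReal * g ω - Real.exp (g ω) + 1) ∂P₀ ≤
        ∫ ω, klFun (P₁.rnDeriv P₀ ω).toReal ∂P₀ :=
      integral_mono (hsub.add (integrable_const 1))
        ((integrable_klFun_rnDeriv_iff hac).2 hint)
        fun ω => mul_sub_exp_le_klFun ENNReal.toReal_nonneg (g ω)
    have hsmul : ∫ ω, (P₁.rnDeriv P₀ ω).toReal * g ω ∂P₀ = ∫ ω, g ω ∂P₁ :=
      integral_rnDeriv_smul hac
    rw [integral_add hsub (integrable_const 1), integral_sub hmul hg₀, hsmul] at hmono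
    simp only [integral_const, probReal_univ, one_smul] at hmono
    linarith
  · exact absurd hKL (by simp)

/-- Pinsker's inequality for a single event. -/
lemma measureReal_sub_le_sqrt_of_KLdiv_le (hγ : 0 ≤ γ)
    (hKL : KLdiv P₁ P₀ ≤ ENNReal.ofReal γ) {A : Set Ω} (hA : MeasurableSet A) :
    P₁.real A - P₀.real A ≤ √(γ / 2) := by
  set p := P₀.real A
  set q := P₁.real A
  set t := 4 * (q - p) with ht
  have hX : Measurable (A.indicator (1 : Ω → ℝ)) := measurable_one.indicator hA
  have hX01 : ∀ ω, A.indicator (1 : Ω → ℝ) ω ∈ Set.Icc (0 : ℝ) 1 := fun ω => by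
    by_cases h : ω ∈ A <;> simp [h]
  have hsub := hasSubgaussianMGF_of_mem_Icc (μ := P₀) hX.aemeasurable (.of_forall hX01)
  rw [integral_indicator_one hA] at hsub
  have hmgf : ∫ ω, Real.exp (t * (A.indicator 1 ω - p)) ∂P₀ ≤ Real.exp (t ^ 2 / 8) := by
    refine (hsub.mgf_le t).trans_eq ?_
    congr 1
    norm_num
    ring
  have hexp : ∀ ω, Real.exp (t * (A.indicator 1 ω - p) - t ^ 2 / 8) =
      Real.exp (t * (A.indicator 1 ω - p)) * Real.exp (-(t ^ 2 / 8)) := fun ω => by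
    rw [← Real.exp_add, sub_eq_add_neg]
  have hI : Integrable (A.indicator (1 : Ω → ℝ)) P₁ :=
    (integrable_const (1 : ℝ)).indicator hA
  have hI' : Integrable (fun ω => t * (A.indicator (1 : Ω → ℝ) ω - p)) P₁ :=
    (hI.sub (integrable_const p)).const_mul t
  have key := integral_sub_integral_exp_le_of_KLdiv_le hγ hKL
    (g := fun ω => t * (A.indicator 1 ω - p) - t ^ 2 / 8)
    (hI'.sub (integrable_const _))
    (by simpa only [hexp] using (hsub.integrable_exp_mul t).mul_const _)
  simp only [hexp] at key
  rw [integral_mul_const, integral_sub hI' (integrable_const _), integral_const_mul,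
    integral_sub hI (integrable_const _), integral_indicator_one hA] at key
  simp only [integral_const, probReal_univ, one_smul] at key
  have hle := mul_le_mul_of_nonneg_right hmgf (Real.exp_pos (-(t ^ 2 / 8))).le
  rw [← Real.exp_add, add_neg_cancel, Real.exp_zero] at hle
  refine Real.le_sqrt_of_sq_le ?_
  change t * (q - p) - t ^ 2 / 8 - _ + 1 ≤ γ at key
  have : t * (q - p) - t ^ 2 / 8 = 2 * (q - p) ^ 2 := by rw [ht]; ring
  linarith

lemma two_point_exp_le_of_KLdiv_le (hγ : 0 ≤ γ)
    (hKL : KLdiv P₁ P₀ ≤ ENNReal.ofReal γ) {A : Set Ω} (hA : MeasurableSet A) (s t : ℝ) :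
    P₁.real A * t + (1 - P₁.real A) * s - P₀.real A * Real.exp t
      - (1 - P₀.real A) * Real.exp s + 1 ≤ γ := by
  have hI : ∀ (P : Measure Ω) [IsProbabilityMeasure P] (c : ℝ),
      Integrable (fun ω => c * A.indicator (1 : Ω → ℝ) ω) P := fun P _ c =>
    ((integrable_const (1 : ℝ)).indicator hA).const_mul c
  have hexp : ∀ ω, Real.exp (s + (t - s) * A.indicator 1 ω) =
      Real.exp s + (Real.exp t - Real.exp s) * A.indicator 1 ω := fun ω => by
    by_cases h : ω ∈ A <;> simp [h]
  have key := integral_sub_integral_exp_le_of_KLdiv_le hγ hKL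
    (g := fun ω => s + (t - s) * A.indicator 1 ω)
    ((integrable_const s).add (hI P₁ _))
    (by simp only [hexp]; exact (integrable_const _).add (hI P₀ _))
  simp only [hexp] at key
  rw [integral_add (integrable_const _) (hI P₁ _), integral_add (integrable_const _) (hI P₀ _),
    integral_const_mul, integral_const_mul, integral_indicator_one hA,
    integral_indicator_one hA] at key
  simp only [integral_const, probReal_univ, one_smul] at key
  linarith

/-- A Bretagnolle–Huber type inequality for a single event. -/
lemma exp_neg_div_four_le_of_KLdiv_le (hγ : 0 ≤ γ)
    (hKL : KLdiv P₁ P₀ ≤ ENNReal.ofReal γ) {A : Set Ω} (hA : MeasurableSet A) {m : ℝ}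
    (h₀ : P₀.real A ≤ m) (h₁ : 1 - P₁.real A ≤ m) : Real.exp (-γ) / 4 ≤ m := by
  have hp : 0 ≤ P₀.real A := measureReal_nonneg
  have hq : P₁.real A ≤ 1 := measureReal_le_one
  have key := two_point_exp_le_of_KLdiv_le hγ hKL hA
  rcases (hp.trans h₀).eq_or_lt with rfl | hm
  · have hk := key 0 (γ + 1)
    rw [le_antisymm h₀ hp, show P₁.real A = 1 by linarith, Real.exp_zero] at hk
    linarith
  rcases le_or_gt 1 m with hm1 | hm1
  · have : Real.exp (-γ) ≤ 1 := Real.exp_le_one_iff.2 (by linarith)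
    linarith
  have hk := key (-Real.log 2) (-Real.log (2 * m))
  rw [Real.exp_neg, Real.exp_neg, Real.exp_log two_pos, Real.exp_log (by positivity),
    Real.log_mul two_ne_zero hm.ne'] at hk
  have hpm : P₀.real A * (2 * m)⁻¹ ≤ 1 / 2 := by
    rw [← div_eq_mul_inv, div_le_iff₀ (by positivity)]
    linarith
  have hlog : Real.log m ≤ 0 := Real.log_nonpos hm.le hm1.le
  have hent : -(m * Real.log m) ≤ 1 / 2 := by
    have h := Real.log_le_sub_one_of_pos (inv_pos.2 (mul_pos two_pos hm))
    rw [Real.log_inv, Real.log_mul two_ne_zero hm.ne'] at h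
    have h' := mul_le_mul_of_nonneg_left h hm.le
    have h2 : m * ((2 * m)⁻¹ - 1) = 1 / 2 - m := by field_simp
    nlinarith [Real.log_two_lt_d9]
  have hqm : (1 - m - P₁.real A) * Real.log m ≥ 0 :=
    mul_nonneg_of_nonpos_of_nonpos (by linarith) hlog
  have hfour : Real.log 4 = 2 * Real.log 2 := by
    rw [show (4 : ℝ) = 2 ^ 2 by norm_num, Real.log_pow]; norm_num
  rw [div_le_iff₀ four_pos, ← Real.le_log_iff_exp_le (by positivity),
    Real.log_mul hm.ne' four_ne_zero, hfour]
  nlinarith [Real.log_two_gt_d9]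

end

/-- Tsybakov's two-point lower bound (expectation version): if `KL(P₁ ‖ P₀) ≤ γ` and
`d(f₀, f₁) ≥ 2a` with `a > 0`, then for any measurable estimator `f̂`,
`max_j E_{P_j}[d(f̂, f_j)] ≥ a · max(e^{-γ}/4, (1 - √(γ/2))/2)`. -/
theorem two_point_lower_bound_expectation
    {Ω : Type*} [MeasurableSpace Ω] (P₀ P₁ : Measure Ω)
    [IsProbabilityMeasure P₀] [IsProbabilityMeasure P₁]
    {γ : ℝ} (hγ : 0 ≤ γ) (hKL : KLdiv P₁ P₀ ≤ ENNReal.ofReal γ)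
    {F : Type*} [PseudoMetricSpace F] [MeasurableSpace F] [BorelSpace F]
    (f₀ f₁ : F) {a : ℝ} (ha : 0 < a) (hd : dist f₀ f₁ ≥ 2 * a)
    (fhat : Ω → F) (hfhat : Measurable fhat) :
    max (∫⁻ ω, ENNReal.ofReal (dist (fhat ω) f₀) ∂P₀)
        (∫⁻ ω, ENNReal.ofReal (dist (fhat ω) f₁) ∂P₁) ≥
      ENNReal.ofReal (a * max (Real.exp (-γ) / 4) ((1 - Real.sqrt (γ / 2)) / 2)) := by
  have hmeas : ∀ f : F, Measurable fun ω => dist (fhat ω) f := fun f =>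
    (continuous_id.dist continuous_const).measurable.comp hfhat
  set A : Set Ω := {ω | a ≤ dist (fhat ω) f₀}
  have hA : MeasurableSet A := measurableSet_le measurable_const (hmeas f₀)
  have markov : ∀ (P : Measure Ω) [IsProbabilityMeasure P] (f : F) (B : Set Ω),
      (∀ ω ∈ B, a ≤ dist (fhat ω) f) →
      ENNReal.ofReal (a * P.real B) ≤ ∫⁻ ω, ENNReal.ofReal (dist (fhat ω) f) ∂P := by
    intro P _ f B hB
    rw [ENNReal.ofReal_mul ha.le, ofReal_measureReal]
    refine le_trans ?_ (mul_meas_ge_le_lintegral (hmeas f).ennreal_ofReal (ENNReal.ofReal a))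
    gcongr
    exact fun ω hω => ENNReal.ofReal_le_ofReal (hB ω hω)
  have h₀ := markov P₀ f₀ A fun ω hω => hω
  have h₁ := markov P₁ f₁ Aᶜ fun ω hω => by
    have hlt : dist (fhat ω) f₀ < a := not_le.1 hω
    linarith [dist_triangle_left f₀ f₁ (fhat ω)]
  rw [probReal_compl_eq_one_sub hA] at h₁
  refine le_trans ?_ (max_le_max h₀ h₁)
  rw [← ENNReal.ofReal_max, ← mul_max_of_nonneg _ _ ha.le]
  refine ENNReal.ofReal_le_ofReal (mul_le_mul_of_nonneg_left (max_le ?_ ?_) ha.le)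
  · exact exp_neg_div_four_le_of_KLdiv_le hγ hKL hA (le_max_left _ _) (le_max_right _ _)
  · linarith [measureReal_sub_le_sqrt_of_KLdiv_le hγ hKL hA,
      le_max_left (P₀.real A) (1 - P₁.real A), le_max_right (P₀.real A) (1 - P₁.real A)]
end

section
/- For all real p, q with |p| ≤ 1/4 and |q| ≤ 1/4, the Kullback–Leibler divergence between the Bernoulli distributions with parameters 1/2 + p and 1/2 + q satisfies kl(1/2 + p, 1/2 + q) ≤ 8 (p − q)². -/
open Real

/-- Kullback–Leibler divergence between `Bernoulli(p)` and `Bernoulli(q)`. -/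
noncomputable def klBer (p q : ℝ) : ℝ :=
  p * Real.log (p / q) + (1 - p) * Real.log ((1 - p) / (1 - q))

/-- The Kullback–Leibler divergence between Bernoulli distributions is at most their
chi-squared divergence. -/
theorem klBer_le_chiSq {p q : ℝ} (hp : p ∈ Set.Ioo 0 1) (hq : q ∈ Set.Ioo 0 1) :
    klBer p q ≤ (p - q) ^ 2 / (q * (1 - q)) := by
  obtain ⟨hp0, hp1⟩ := hp
  obtain ⟨hq0, hq1⟩ := hq
  have hp1' : 0 < 1 - p := sub_pos.2 hp1
  have hq1' : 0 < 1 - q := sub_pos.2 hq1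
  calc klBer p q ≤ p * (p / q - 1) + (1 - p) * ((1 - p) / (1 - q) - 1) := by
        unfold klBer
        gcongr
        · exact Real.log_le_sub_one_of_pos (div_pos hp0 hq0)
        · exact Real.log_le_sub_one_of_pos (div_pos hp1' hq1')
    _ = (p - q) ^ 2 / (q * (1 - q)) := by
        field_simp
        ring

/-- For `|p| ≤ 1/4` and `|q| ≤ 1/4`,
`kl(1/2 + p, 1/2 + q) ≤ 8 (p - q)²`. -/
theorem klBer_half_add_le (p q : ℝ) (hp : |p| ≤ 1 / 4) (hq : |q| ≤ 1 / 4) :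
    klBer (1 / 2 + p) (1 / 2 + q) ≤ 8 * (p - q) ^ 2 := by
  obtain ⟨hp1, hp2⟩ := abs_le.1 hp
  obtain ⟨hq1, hq2⟩ := abs_le.1 hq
  have hvar : 1 / 8 ≤ (1 / 2 + q) * (1 - (1 / 2 + q)) := by nlinarith
  refine (klBer_le_chiSq ⟨by linarith, by linarith⟩ ⟨by linarith, by linarith⟩).trans ?_
  rw [add_sub_add_left_eq_sub, div_le_iff₀ (by linarith)]
  nlinarith [mul_le_mul_of_nonneg_left hvar (sq_nonneg (p - q))]
end

section
/- Let σ > 0, c ∈ (0, 1/2), and 0 < a ≤ σ. Then for all w ∈ ℝ: F_{−a}(w) − F_{a}(w) = (c/σ)(w + a + σ) if w ∈ [−a−σ, a−σ]; F_{−a}(w) − F_{a}(w) = 2ac/σ if w ∈ [a−σ, σ−a]; F_{−a}(w) − F_{a}(w) = (c/σ)(a + σ − w) if w ∈ [σ−a, a+σ]; and F_{−a}(w) − F_{a}(w) = 0 otherwise. In particular, sup_{w ∈ ℝ} |F_{−a}(w) − F_{a}(w)| = 2ac/σ. -/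
open MeasureTheory

/-- Uniform-noise convolution: `(g ⋆ U_σ)(w) = (1/(2σ)) ∫_{w-σ}^{w+σ} g(x) dx`. -/
noncomputable def unifConv (σ : ℝ) (g : ℝ → ℝ) (w : ℝ) : ℝ :=
  (1 / (2 * σ)) * ∫ x in (w - σ)..(w + σ), g x

/-- Step regression function with threshold `t` and jump size `c`. -/
noncomputable def stepFn (c t : ℝ) (x : ℝ) : ℝ :=
  if x < t then 1 / 2 - c else 1 / 2 + c

theorem stepFn_monotone {c : ℝ} (hc : 0 ≤ c) (t : ℝ) : Monotone (stepFn c t) := by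
  intro x y hxy
  unfold stepFn
  split_ifs <;> linarith

theorem hasDerivAt_half_add_mul_abs_sub (c : ℝ) {t x : ℝ} (hx : x ≠ t) :
    HasDerivAt (fun y => y / 2 + c * |y - t|) (stepFn c t x) x := by
  have hlin : HasDerivAt (fun y : ℝ => y / 2) (1 / 2) x := (hasDerivAt_id x).div_const 2
  have hsub : HasDerivAt (fun y : ℝ => y - t) 1 x := (hasDerivAt_id x).sub_const t
  rcases lt_or_gt_of_ne hx with h | h
  · have habs := (hasDerivAt_abs_neg (sub_neg.2 h)).comp x hsub
    exact (hlin.add (habs.const_mul c)).congr_deriv (by simp [stepFn, h, sub_eq_add_neg])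
  · have habs := (hasDerivAt_abs_pos (sub_pos.2 h)).comp x hsub
    exact (hlin.add (habs.const_mul c)).congr_deriv (by simp [stepFn, h.le])

theorem integral_stepFn {c : ℝ} (hc : 0 ≤ c) (t p q : ℝ) :
    ∫ x in p..q, stepFn c t x = (q / 2 + c * |q - t|) - (p / 2 + c * |p - t|) :=
  integral_eq_of_hasDerivAt_off_countable (fun y => y / 2 + c * |y - t|) (stepFn c t)
    (Set.countable_singleton t) (by fun_prop)
    (fun _ hx => hasDerivAt_half_add_mul_abs_sub c hx.2)
    (stepFn_monotone hc t).intervalIntegrable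

theorem unifConv_stepFn_sub {σ c : ℝ} (hc : 0 ≤ c) (s t w : ℝ) :
    unifConv σ (stepFn c s) w - unifConv σ (stepFn c t) w =
      c / (2 * σ) * (|w + σ - s| - |w - σ - s| - (|w + σ - t| - |w - σ - t|)) := by
  simp only [unifConv, integral_stepFn hc]
  ring

/-- Difference of the convolved step regression functions with thresholds `-a` and `a`,
in the regime `0 < a ≤ σ`; the maximal difference is `2ac/σ`. -/
theorem unifConv_stepFn_diff_small_sep (σ c a : ℝ) (hσ : 0 < σ)
    (hc : c ∈ Set.Ioo (0 : ℝ) (1 / 2)) (ha : 0 < a) (haσ : a ≤ σ) :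
    (∀ w : ℝ,
      (w ∈ Set.Icc (-a - σ) (a - σ) →
        unifConv σ (stepFn c (-a)) w - unifConv σ (stepFn c a) w = (c / σ) * (w + a + σ)) ∧
      (w ∈ Set.Icc (a - σ) (σ - a) →
        unifConv σ (stepFn c (-a)) w - unifConv σ (stepFn c a) w = 2 * a * c / σ) ∧
      (w ∈ Set.Icc (σ - a) (a + σ) →
        unifConv σ (stepFn c (-a)) w - unifConv σ (stepFn c a) w = (c / σ) * (a + σ - w)) ∧
      (w ∉ Set.Icc (-a - σ) (a + σ) →
        unifConv σ (stepFn c (-a)) w - unifConv σ (stepFn c a) w = 0)) ∧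
    (⨆ w : ℝ, |unifConv σ (stepFn c (-a)) w - unifConv σ (stepFn c a) w| = 2 * a * c / σ) := by
  have hc0 : 0 < c := hc.1
  have hdiff (w : ℝ) := unifConv_stepFn_sub (σ := σ) hc0.le (-a) a w
  refine ⟨fun w => ⟨?_, ?_, ?_, ?_⟩, ?_⟩
  · rintro ⟨h₁, h₂⟩
    rw [hdiff, abs_of_nonneg (by linarith : 0 ≤ w + σ - -a),
      abs_of_nonpos (by linarith : w - σ - -a ≤ 0),
      abs_of_nonpos (by linarith : w - σ - a ≤ 0)]
    rcases abs_cases (w + σ - a) with ⟨h, _⟩ | ⟨h, _⟩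
    · have hw : w = a - σ := by linarith
      subst hw
      rw [h]
      field_simp
      ring
    · rw [h]
      field_simp
      ring
  · rintro ⟨h₁, h₂⟩
    rw [hdiff, abs_of_nonneg (by linarith : 0 ≤ w + σ - -a),
      abs_of_nonpos (by linarith : w - σ - -a ≤ 0),
      abs_of_nonneg (by linarith : 0 ≤ w + σ - a),
      abs_of_nonpos (by linarith : w - σ - a ≤ 0)]
    field_simp
    ring
  · rintro ⟨h₁, h₂⟩
    rw [hdiff, abs_of_nonneg (by linarith : 0 ≤ w + σ - -a),
      abs_of_nonneg (by linarith : 0 ≤ w - σ - -a),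
      abs_of_nonneg (by linarith : 0 ≤ w + σ - a),
      abs_of_nonpos (by linarith : w - σ - a ≤ 0)]
    field_simp
    ring
  · intro h
    rw [hdiff]
    refine mul_eq_zero_of_right _ ?_
    rw [Set.mem_Icc, not_and_or, not_le, not_le] at h
    rcases h with h | h
    · rw [abs_of_nonpos (by linarith : w + σ - -a ≤ 0),
        abs_of_nonpos (by linarith : w - σ - -a ≤ 0),
        abs_of_nonpos (by linarith : w + σ - a ≤ 0),
        abs_of_nonpos (by linarith : w - σ - a ≤ 0)]
      ring
    · rw [abs_of_nonneg (by linarith : 0 ≤ w + σ - -a),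
        abs_of_nonneg (by linarith : 0 ≤ w - σ - -a),
        abs_of_nonneg (by linarith : 0 ≤ w + σ - a),
        abs_of_nonneg (by linarith : 0 ≤ w - σ - a)]
      ring
  · have hle (w : ℝ) :
        |unifConv σ (stepFn c (-a)) w - unifConv σ (stepFn c a) w| ≤ 2 * a * c / σ := by
      have hbound : |(|w + σ - -a| - |w - σ - -a| - (|w + σ - a| - |w - σ - a|))| ≤ 4 * a := by
        have h₁ := abs_le.1 (abs_abs_sub_abs_le (w + σ - -a) (w + σ - a))
        have h₂ := abs_le.1 (abs_abs_sub_abs_le (w - σ - -a) (w - σ - a))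
        have h₃ : |w + σ - -a - (w + σ - a)| = 2 * a := by
          rw [abs_of_pos] <;> linarith
        have h₄ : |w - σ - -a - (w - σ - a)| = 2 * a := by
          rw [abs_of_pos] <;> linarith
        exact abs_le.2 ⟨by linarith, by linarith⟩
      rw [hdiff, abs_mul, abs_of_pos (by positivity : 0 < c / (2 * σ))]
      calc c / (2 * σ) * _ ≤ c / (2 * σ) * (4 * a) := by gcongr
        _ = 2 * a * c / σ := by field_simp; ring
    have hzero : |unifConv σ (stepFn c (-a)) 0 - unifConv σ (stepFn c a) 0| = 2 * a * c / σ := by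
      rw [hdiff, abs_of_nonneg (by linarith : 0 ≤ 0 + σ - -a),
        abs_of_nonpos (by linarith : 0 - σ - -a ≤ 0),
        abs_of_nonneg (by linarith : 0 ≤ 0 + σ - a),
        abs_of_nonpos (by linarith : 0 - σ - a ≤ 0)]
      rw [show c / (2 * σ) * (0 + σ - -a - -(0 - σ - -a) - (0 + σ - a - -(0 - σ - a))) =
        2 * a * c / σ by field_simp; ring]
      exact abs_of_pos (by positivity)
    exact le_antisymm (ciSup_le hle)
      (hzero.ge.trans (le_ciSup ⟨_, Set.forall_mem_range.2 hle⟩ (0 : ℝ)))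
end

section
/- Let c ∈ (0, 1/2) and 0 < σ < a. Then for all w ∈ ℝ: F_{−a}(w) − F_{a}(w) = (c/σ)(w + a + σ) if w ∈ [−a−σ, −a+σ]; F_{−a}(w) − F_{a}(w) = 2c if w ∈ [−a+σ, a−σ]; F_{−a}(w) − F_{a}(w) = (c/σ)(a + σ − w) if w ∈ [a−σ, a+σ]; and F_{−a}(w) − F_{a}(w) = 0 otherwise. In particular, sup_{w ∈ ℝ} |F_{−a}(w) − F_{a}(w)| = 2c. -/
open MeasureTheory

theorem integral_stepFn_from_threshold (c t q : ℝ) :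
    ∫ x in t..q, stepFn c t x = (q - t) / 2 + c * |q - t| := by
  rcases le_or_gt t q with h | h
  · have hconst : ∫ x in t..q, stepFn c t x = ∫ _ in t..q, (1 / 2 + c) := by
      refine intervalIntegral.integral_congr fun x hx => ?_
      rw [Set.uIcc_of_le h] at hx
      exact if_neg hx.1.not_gt
    rw [hconst, intervalIntegral.integral_const, smul_eq_mul, abs_of_nonneg (by linarith)]
    ring
  · have hconst : ∫ x in t..q, stepFn c t x = ∫ _ in t..q, (1 / 2 - c) := by
      refine intervalIntegral.integral_congr_ae ?_
      filter_upwards [Measure.ae_ne volume t] with x hxt hx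
      rw [Set.uIoc_of_ge h.le] at hx
      exact if_pos (lt_of_le_of_ne hx.2 hxt)
    rw [hconst, intervalIntegral.integral_const, smul_eq_mul, abs_of_neg (by linarith)]
    ring

/-- Closed form of the uniform-noise convolution of a step regression function. -/
theorem unifConv_stepFn {σ c : ℝ} (hσ : 0 < σ) (hc : 0 ≤ c) (t w : ℝ) :
    unifConv σ (stepFn c t) w = 1 / 2 + c / (2 * σ) * (|w + σ - t| - |w - σ - t|) := by
  have hint (p q : ℝ) : IntervalIntegrable (stepFn c t) volume p q :=
    (stepFn_monotone hc t).intervalIntegrable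
  rw [unifConv, ← intervalIntegral.integral_interval_sub_left (hint t _) (hint t _),
    integral_stepFn_from_threshold, integral_stepFn_from_threshold]
  field_simp
  ring

/-- Difference of the convolved step regression functions with thresholds `-a` and `a`,
in the regime `0 < σ < a`; the maximal difference is `2c`. -/
theorem unifConv_stepFn_diff_large_sep (σ c a : ℝ) (hc : c ∈ Set.Ioo (0 : ℝ) (1 / 2))
    (hσ : 0 < σ) (hσa : σ < a) :
    (∀ w : ℝ,
      (w ∈ Set.Icc (-a - σ) (-a + σ) →
        unifConv σ (stepFn c (-a)) w - unifConv σ (stepFn c a) w = (c / σ) * (w + a + σ)) ∧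
      (w ∈ Set.Icc (-a + σ) (a - σ) →
        unifConv σ (stepFn c (-a)) w - unifConv σ (stepFn c a) w = 2 * c) ∧
      (w ∈ Set.Icc (a - σ) (a + σ) →
        unifConv σ (stepFn c (-a)) w - unifConv σ (stepFn c a) w = (c / σ) * (a + σ - w)) ∧
      (w ∉ Set.Icc (-a - σ) (a + σ) →
        unifConv σ (stepFn c (-a)) w - unifConv σ (stepFn c a) w = 0)) ∧
    (⨆ w : ℝ, |unifConv σ (stepFn c (-a)) w - unifConv σ (stepFn c a) w| = 2 * c) := by
  obtain ⟨hc, -⟩ := hc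
  have hdiff (w : ℝ) : unifConv σ (stepFn c (-a)) w - unifConv σ (stepFn c a) w =
      c / (2 * σ) * (|w + a + σ| - |w + a - σ| - |w - a + σ| + |w - a - σ|) := by
    rw [unifConv_stepFn hσ hc.le, unifConv_stepFn hσ hc.le]
    ring_nf
  have hnonneg (w : ℝ) :
      0 ≤ |w + a + σ| - |w + a - σ| - |w - a + σ| + |w - a - σ| := by
    grind
  have hle (w : ℝ) :
      |w + a + σ| - |w + a - σ| - |w - a + σ| + |w - a - σ| ≤ 4 * σ := by
    grind
  have hplateau (w : ℝ) (hw : w ∈ Set.Icc (-a + σ) (a - σ)) :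
      unifConv σ (stepFn c (-a)) w - unifConv σ (stepFn c a) w = 2 * c := by
    obtain ⟨h₁, h₂⟩ := hw
    have h : |w + a + σ| - |w + a - σ| - |w - a + σ| + |w - a - σ| = 4 * σ := by
      grind
    rw [hdiff, h]
    field_simp
    norm_num
  refine ⟨fun w => ⟨fun ⟨h₁, h₂⟩ => ?_, hplateau w, fun ⟨h₁, h₂⟩ => ?_, fun hw => ?_⟩, ?_⟩
  · have h : |w + a + σ| - |w + a - σ| - |w - a + σ| + |w - a - σ| = 2 * (w + a + σ) := by
      grind
    rw [hdiff, h]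
    field_simp
  · have h : |w + a + σ| - |w + a - σ| - |w - a + σ| + |w - a - σ| = 2 * (a + σ - w) := by
      grind
    rw [hdiff, h]
    field_simp
  · have h : |w + a + σ| - |w + a - σ| - |w - a + σ| + |w - a - σ| = 0 := by
      rw [Set.mem_Icc] at hw
      grind
    rw [hdiff, h, mul_zero]
  · have hbound (w : ℝ) :
        |unifConv σ (stepFn c (-a)) w - unifConv σ (stepFn c a) w| ≤ 2 * c := by
      rw [hdiff, abs_of_nonneg (mul_nonneg (by positivity) (hnonneg w))]
      calc _ ≤ c / (2 * σ) * (4 * σ) := by gcongr; exact hle w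
        _ = 2 * c := by field_simp; norm_num
    refine le_antisymm (ciSup_le hbound) ?_
    refine le_ciSup_of_le ⟨2 * c, Set.forall_mem_range.2 hbound⟩ 0 ?_
    rw [hplateau 0 ⟨by linarith, by linarith⟩]
    exact le_abs_self _
end

section
/- (Unflattening of the regression function by uniform noise.) Let σ > 0, c > 0, t ∈ ℝ, and let k ≥ 2 be real. Let m : ℝ → ℝ be a bounded measurable function satisfying (i) m(t+u) − 1/2 = 1/2 − m(t−u) for all u ∈ [0, σ], and (ii) m(t+u) ≥ 1/2 + c·u^{k−1} for all u ∈ [0, 2σ]. Then for every δ ∈ [0, σ], (m ⋆ U_σ)(t + δ) − (m ⋆ U_σ)(t) ≥ (c/(2kσ)) ( (σ+δ)^k − (σ−δ)^k ) ≥ c·σ^{k−2}·δ; in particular (m ⋆ U_σ)(t + δ) ≥ 1/2 + c·σ^{k−2}·δ. -/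
open MeasureTheory Real

/-- The integral of a function that is odd on `[-a, a]` vanishes. -/
theorem intervalIntegral_eq_zero_of_odd_on {f : ℝ → ℝ} {a : ℝ} (ha : 0 ≤ a)
    (hf : ∀ u ∈ Set.Icc (0 : ℝ) a, f (-u) = -f u) : ∫ u in (-a)..a, f u = 0 := by
  have h : ∫ u in (-a)..a, f (-u) = ∫ u in (-a)..a, -f u := by
    refine intervalIntegral.integral_congr fun u hu => ?_
    rw [Set.uIcc_of_le (by linarith)] at hu
    rcases le_total 0 u with h0 | h0
    · exact hf u ⟨h0, hu.2⟩
    · have := hf (-u) ⟨by linarith, by linarith [hu.1]⟩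
      rw [neg_neg] at this
      simp only [this, neg_neg]
  rw [intervalIntegral.integral_comp_neg, neg_neg, intervalIntegral.integral_neg] at h
  linarith

/-- A bounded measurable function is interval integrable. -/
theorem Measurable.intervalIntegrable_of_abs_le {f : ℝ → ℝ} (hf : Measurable f) {M : ℝ}
    (hM : ∀ x, |f x| ≤ M) (a b : ℝ) : IntervalIntegrable f volume a b :=
  (intervalIntegrable_const (c := M)).mono_fun hf.aestronglyMeasurable <|
    Filter.Eventually.of_forall fun x => (hM x).trans (le_abs_self M)

/-- The uniform-noise convolution of a function antisymmetric around `t` only sees the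
part of the window that is not symmetric around `t`. -/
theorem unifConv_add_of_antisymm {σ t δ : ℝ} (hσ : 0 < σ) (hδ : δ ∈ Set.Icc (0 : ℝ) σ)
    {m : ℝ → ℝ} (hint : ∀ a b, IntervalIntegrable m volume a b)
    (hantisym : ∀ u ∈ Set.Icc (0 : ℝ) σ, m (t + u) - 1 / 2 = 1 / 2 - m (t - u)) :
    unifConv σ m (t + δ) =
      1 / 2 + 1 / (2 * σ) * ∫ u in (σ - δ)..(σ + δ), (m (t + u) - 1 / 2) := by
  have hm : ∀ a b, IntervalIntegrable (fun u => m (t + u)) volume a b := fun a b => by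
    simpa using (hint (t + a) (t + b)).comp_add_left t
  have hf : ∀ a b, IntervalIntegrable (fun u => m (t + u) - 1 / 2) volume a b :=
    fun a b => (hm a b).sub intervalIntegrable_const
  have hodd : ∫ u in (-(σ - δ))..(σ - δ), (m (t + u) - 1 / 2) = 0 := by
    refine intervalIntegral_eq_zero_of_odd_on (by linarith [hδ.2]) fun u hu => ?_
    have := hantisym u ⟨hu.1, by linarith [hu.2, hδ.1]⟩
    rw [← sub_eq_add_neg]
    linarith
  have hadd := intervalIntegral.integral_add_adjacent_intervals
    (hf (-(σ - δ)) (σ - δ)) (hf (σ - δ) (σ + δ))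
  have hshift : ∫ u in (-(σ - δ))..(σ + δ), m (t + u) =
      ∫ x in (t + δ - σ)..(t + δ + σ), m x := by
    rw [intervalIntegral.integral_comp_add_left]
    congr 1 <;> ring
  rw [hodd, zero_add,
    intervalIntegral.integral_sub (hm (-(σ - δ)) (σ + δ)) intervalIntegrable_const,
    hshift, intervalIntegral.integral_const, smul_eq_mul] at hadd
  rw [unifConv, hadd]
  field_simp
  ring

/-- Tangent-line inequality for `x ↦ x ^ p` with `1 ≤ p`. -/
theorem rpow_add_mul_sub_le_rpow {x y p : ℝ} (hx : 0 < x) (hy : 0 ≤ y) (hp : 1 ≤ p) :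
    x ^ p + p * x ^ (p - 1) * (y - x) ≤ y ^ p := by
  have hb := one_add_mul_self_le_rpow_one_add (s := y / x - 1)
    (by linarith [div_nonneg hy hx.le]) hp
  rw [add_sub_cancel, div_rpow hy hx.le, le_div_iff₀ (rpow_pos_of_pos hx p)] at hb
  refine le_trans (le_of_eq ?_) hb
  rw [rpow_sub_one hx.ne']
  field_simp

/-- The symmetric difference of `x ↦ x ^ k`, with `2 ≤ k`, is at least its linearization. -/
theorem two_mul_rpow_le_rpow_add_sub_rpow_sub {x δ k : ℝ} (hx : 0 < x)
    (hδ : δ ∈ Set.Icc (0 : ℝ) x) (hk : 2 ≤ k) :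
    2 * k * x ^ (k - 1) * δ ≤ (x + δ) ^ k - (x - δ) ^ k := by
  have hmono : ∫ u in (x - δ)..(x + δ),
      (x ^ (k - 1) + (k - 1) * x ^ (k - 1 - 1) * (u - x)) ≤
      ∫ u in (x - δ)..(x + δ), u ^ (k - 1) := by
    refine intervalIntegral.integral_mono_on (by linarith [hδ.1])
      (Continuous.intervalIntegrable (by fun_prop) _ _)
      (intervalIntegral.intervalIntegrable_rpow' (by linarith)) fun u hu => ?_
    exact rpow_add_mul_sub_le_rpow hx (by linarith [hu.1, hδ.2]) (by linarith)
  rw [integral_rpow (Or.inl (by linarith)), sub_add_cancel, le_div_iff₀ (by linarith),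
    intervalIntegral.integral_add intervalIntegrable_const
      (Continuous.intervalIntegrable (by fun_prop) _ _),
    intervalIntegral.integral_const_mul, intervalIntegral.integral_const,
    intervalIntegral.integral_sub (Continuous.intervalIntegrable (by fun_prop) _ _)
      intervalIntegrable_const, integral_id, intervalIntegral.integral_const,
    smul_eq_mul, smul_eq_mul] at hmono
  linarith

/-- Unflattening of the regression function by uniform noise: if `m` is bounded,
measurable, locally antisymmetric around the threshold `t`, and grows at least like
`c·u^{k-1}` to the right of `t`, then the convolved regression function grows at
least linearly with slope `c·σ^{k-2}` on `[t, t+σ]`. -/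
theorem unifConv_unflattening (σ c t k : ℝ) (hσ : 0 < σ) (hc : 0 < c) (hk : 2 ≤ k)
    (m : ℝ → ℝ) (hmeas : Measurable m) (M : ℝ) (hbd : ∀ x, |m x| ≤ M)
    (hantisym : ∀ u ∈ Set.Icc (0 : ℝ) σ, m (t + u) - 1 / 2 = 1 / 2 - m (t - u))
    (hgrow : ∀ u ∈ Set.Icc (0 : ℝ) (2 * σ), m (t + u) ≥ 1 / 2 + c * u ^ (k - 1)) :
    ∀ δ ∈ Set.Icc (0 : ℝ) σ,
      unifConv σ m (t + δ) - unifConv σ m t ≥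
          (c / (2 * k * σ)) * ((σ + δ) ^ k - (σ - δ) ^ k) ∧
      (c / (2 * k * σ)) * ((σ + δ) ^ k - (σ - δ) ^ k) ≥ c * σ ^ (k - 2) * δ ∧
      unifConv σ m (t + δ) ≥ 1 / 2 + c * σ ^ (k - 2) * δ := by
  intro δ hδ
  have hint := hmeas.intervalIntegrable_of_abs_le hbd
  have hshifted : unifConv σ m (t + δ) =
      1 / 2 + 1 / (2 * σ) * ∫ u in (σ - δ)..(σ + δ), (m (t + u) - 1 / 2) :=
    unifConv_add_of_antisymm hσ hδ hint hantisym
  have hcenter : unifConv σ m t = 1 / 2 := by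
    simpa using unifConv_add_of_antisymm hσ ⟨le_rfl, hσ.le⟩ hint hantisym
  have hmono : ∫ u in (σ - δ)..(σ + δ), c * u ^ (k - 1) ≤
      ∫ u in (σ - δ)..(σ + δ), (m (t + u) - 1 / 2) := by
    refine intervalIntegral.integral_mono_on (by linarith [hδ.1])
      ((intervalIntegral.intervalIntegrable_rpow' (by linarith)).const_mul c)
      (IntervalIntegrable.sub ?_ intervalIntegrable_const) fun u hu => ?_
    · simpa using (hint (t + (σ - δ)) (t + (σ + δ))).comp_add_left t
    · have := hgrow u ⟨by linarith [hu.1, hδ.2], by linarith [hu.2, hδ.2]⟩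
      linarith
  rw [intervalIntegral.integral_const_mul, integral_rpow (Or.inl (by linarith)),
    sub_add_cancel] at hmono
  have hlower : unifConv σ m (t + δ) - unifConv σ m t ≥
      (c / (2 * k * σ)) * ((σ + δ) ^ k - (σ - δ) ^ k) := by
    rw [hshifted, hcenter, add_sub_cancel_left]
    refine le_trans (le_of_eq ?_) (mul_le_mul_of_nonneg_left hmono (by positivity))
    field_simp
  have hlinear : (c / (2 * k * σ)) * ((σ + δ) ^ k - (σ - δ) ^ k) ≥ c * σ ^ (k - 2) * δ := by
    refine le_trans (le_of_eq ?_) (mul_le_mul_of_nonneg_left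
      (two_mul_rpow_le_rpow_add_sub_rpow_sub hσ hδ hk) (by positivity))
    rw [show k - 1 = k - 2 + 1 by ring, rpow_add_one hσ.ne']
    field_simp
  exact ⟨hlower, hlinear, by linarith⟩
end

section
/- Fix real k > 1 and 0 < c < C, and let β = 1 / (1 − (c/C)^{1/(k−1)}). There exist constants ρ ∈ (0, 1) and 0 < c₁ ≤ C₁ < ∞, depending only on c, C and k, such that for all a > 0 and σ > 0 with σ ≤ ρ·a, c₁·a^{k−1} ≤ sup_{w ≥ 0} |F₁(w) − F₂(w)| ≤ C₁·a^{k−1}. -/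
open MeasureTheory Real

/-- The regression function `m₁(x) = 1/2 + c·sgn(x)·|x|^{k-1}` with threshold `0`. -/
noncomputable def regFn₁ (c k : ℝ) (x : ℝ) : ℝ :=
  1 / 2 + c * Real.sign x * |x| ^ (k - 1)

/-- The shifted regression function `m₂`, with threshold `a`, which agrees with
`1/2 + c·sgn(x-a)·|x-a|^{k-1}` for `x < βa + σ` and with `m₁` for `x ≥ βa + σ`. -/
noncomputable def regFn₂ (c k a β σ : ℝ) (x : ℝ) : ℝ :=
  if x < β * a + σ then 1 / 2 + c * Real.sign (x - a) * |x - a| ^ (k - 1)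
  else regFn₁ c k x

theorem measurable_real_sign : Measurable Real.sign := by
  unfold Real.sign
  exact Measurable.ite measurableSet_Iio measurable_const
    (Measurable.ite measurableSet_Ioi measurable_const measurable_const)

theorem abs_real_sign_le_one (x : ℝ) : |Real.sign x| ≤ 1 := by
  rcases Real.sign_apply_eq x with h | h | h <;> simp [h]

theorem abs_mul_sign_mul_rpow_le {c : ℝ} (hc : 0 ≤ c) (p x : ℝ) :
    |c * Real.sign x * |x| ^ p| ≤ c * |x| ^ p := by
  have hp : 0 ≤ |x| ^ p := Real.rpow_nonneg (abs_nonneg x) p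
  rw [abs_mul, abs_mul, abs_of_nonneg hc, abs_of_nonneg hp]
  exact mul_le_mul_of_nonneg_right
    (mul_le_of_le_one_right hc (abs_real_sign_le_one x)) hp

theorem measurable_regFn₁ (c k : ℝ) : Measurable (regFn₁ c k) := by
  unfold regFn₁
  exact measurable_const.add
    ((measurable_const.mul measurable_real_sign).mul (measurable_id.abs.pow_const _))

theorem measurable_regFn₂ (c k a β σ : ℝ) : Measurable (regFn₂ c k a β σ) := by
  have h : Measurable fun x : ℝ => regFn₁ c k (x - a) :=
    (measurable_regFn₁ c k).comp (measurable_id.sub_const a)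
  exact Measurable.ite measurableSet_Iio h (measurable_regFn₁ c k)

theorem abs_regFn₁_le {c : ℝ} (hc : 0 ≤ c) (k x : ℝ) :
    |regFn₁ c k x| ≤ 1 / 2 + c * |x| ^ (k - 1) := by
  refine (abs_add_le _ _).trans (add_le_add (by norm_num) ?_)
  exact abs_mul_sign_mul_rpow_le hc _ _

theorem abs_regFn₂_le {c : ℝ} (hc : 0 ≤ c) (k a β σ x : ℝ) :
    |regFn₂ c k a β σ x| ≤ 1 / 2 + c * |x - a| ^ (k - 1) + c * |x| ^ (k - 1) := by
  have h₁ : 0 ≤ c * |x - a| ^ (k - 1) := by positivity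
  have h₂ : 0 ≤ c * |x| ^ (k - 1) := by positivity
  unfold regFn₂
  split_ifs
  · exact (abs_regFn₁_le hc k (x - a)).trans (by linarith)
  · exact (abs_regFn₁_le hc k x).trans (by linarith)

theorem intervalIntegrable_regFn₁ {c k : ℝ} (hk : 1 < k) (hc : 0 ≤ c) (u v : ℝ) :
    IntervalIntegrable (regFn₁ c k) volume u v := by
  have hcont : Continuous fun x : ℝ => 1 / 2 + c * |x| ^ (k - 1) :=
    continuous_const.add (continuous_const.mul
      (continuous_abs.rpow_const fun _ => Or.inr (by linarith)))
  refine (hcont.intervalIntegrable u v).mono_fun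
    (measurable_regFn₁ c k).aestronglyMeasurable (Filter.Eventually.of_forall fun x => ?_)
  exact (abs_regFn₁_le hc k x).trans (le_abs_self _)

theorem intervalIntegrable_regFn₂ {c k : ℝ} (hk : 1 < k) (hc : 0 ≤ c) (a β σ u v : ℝ) :
    IntervalIntegrable (regFn₂ c k a β σ) volume u v := by
  have hcont : Continuous fun x : ℝ => 1 / 2 + c * |x - a| ^ (k - 1) + c * |x| ^ (k - 1) :=
    (continuous_const.add (continuous_const.mul
      ((continuous_id.sub continuous_const).abs.rpow_const fun _ => Or.inr (by linarith)))).add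
      (continuous_const.mul (continuous_abs.rpow_const fun _ => Or.inr (by linarith)))
  refine (hcont.intervalIntegrable u v).mono_fun
    (measurable_regFn₂ c k a β σ).aestronglyMeasurable (Filter.Eventually.of_forall fun x => ?_)
  exact (abs_regFn₂_le hc k a β σ x).trans (le_abs_self _)

theorem unifConv_sub {σ w : ℝ} {f g : ℝ → ℝ}
    (hf : IntervalIntegrable f volume (w - σ) (w + σ))
    (hg : IntervalIntegrable g volume (w - σ) (w + σ)) :
    unifConv σ f w - unifConv σ g w = unifConv σ (fun x => f x - g x) w := by
  rw [unifConv, unifConv, unifConv, intervalIntegral.integral_sub hf hg, mul_sub]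

theorem abs_unifConv_le {σ w M : ℝ} {f : ℝ → ℝ} (hσ : 0 < σ)
    (hf : ∀ x ∈ Set.Ioc (w - σ) (w + σ), |f x| ≤ M) : |unifConv σ f w| ≤ M := by
  have hle : w - σ ≤ w + σ := by linarith
  have h := intervalIntegral.norm_integral_le_of_norm_le_const (f := f) (C := M)
    (a := w - σ) (b := w + σ) (by rwa [Set.uIoc_of_le hle])
  rw [Real.norm_eq_abs, show w + σ - (w - σ) = 2 * σ by ring,
    abs_of_pos (by positivity : 0 < 2 * σ)] at h
  rw [unifConv, abs_mul, abs_of_pos (by positivity : 0 < 1 / (2 * σ)), one_div_mul_eq_div]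
  exact (div_le_iff₀ (by positivity)).2 h

theorem le_unifConv {σ w m : ℝ} {f : ℝ → ℝ} (hσ : 0 < σ)
    (hi : IntervalIntegrable f volume (w - σ) (w + σ))
    (hf : ∀ x ∈ Set.Icc (w - σ) (w + σ), m ≤ f x) : m ≤ unifConv σ f w := by
  have h := intervalIntegral.integral_mono_on (by linarith : w - σ ≤ w + σ)
    intervalIntegrable_const hi hf
  rw [intervalIntegral.integral_const, smul_eq_mul] at h
  rw [unifConv, one_div_mul_eq_div, le_div_iff₀ (by positivity)]
  linarith

theorem abs_regFn₁_sub_regFn₂_le {c k a β σ x : ℝ} (hk : 1 < k) (hc : 0 ≤ c) (ha : 0 < a)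
    (hβ : 1 ≤ β) (hσ : σ ≤ a) (hx : -a ≤ x) :
    |regFn₁ c k x - regFn₂ c k a β σ x| ≤ 2 * c * (β + 1) ^ (k - 1) * a ^ (k - 1) := by
  rw [mul_assoc (2 * c), ← Real.mul_rpow (by linarith) ha.le]
  have hβa : a ≤ β * a := le_mul_of_one_le_left ha.le hβ
  unfold regFn₂
  split_ifs with h
  · have h₁ : |x| ^ (k - 1) ≤ ((β + 1) * a) ^ (k - 1) :=
      Real.rpow_le_rpow (abs_nonneg x) (abs_le.2 ⟨by linarith, by linarith⟩) (by linarith)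
    have h₂ : |x - a| ^ (k - 1) ≤ ((β + 1) * a) ^ (k - 1) :=
      Real.rpow_le_rpow (abs_nonneg _) (abs_le.2 ⟨by linarith, by linarith⟩) (by linarith)
    have h₃ := abs_mul_sign_mul_rpow_le hc (k - 1) x
    have h₄ := abs_mul_sign_mul_rpow_le hc (k - 1) (x - a)
    have h₅ := mul_le_mul_of_nonneg_left h₁ hc
    have h₆ := mul_le_mul_of_nonneg_left h₂ hc
    rw [regFn₁, add_sub_add_left_eq_sub]
    refine (abs_sub _ _).trans ?_
    linarith
  · rw [sub_self, abs_zero]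
    have : 0 ≤ (β + 1) * a := by linarith
    positivity

theorem le_regFn₁_sub_regFn₂ {c k a β σ x : ℝ} (hk : 1 < k) (hc : 0 ≤ c) (ha : 0 < a)
    (hβ : 1 ≤ β) (hσ : 0 < σ) (hx₁ : a / 4 ≤ x) (hx₂ : x ≤ 3 * a / 4) :
    2 * c * (1 / 4) ^ (k - 1) * a ^ (k - 1) ≤ regFn₁ c k x - regFn₂ c k a β σ x := by
  rw [mul_assoc (2 * c), ← Real.mul_rpow (by norm_num) ha.le]
  have hβa : a ≤ β * a := le_mul_of_one_le_left ha.le hβ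
  have h₁ : (1 / 4 * a) ^ (k - 1) ≤ x ^ (k - 1) :=
    Real.rpow_le_rpow (by linarith) (by linarith) (by linarith)
  have h₂ : (1 / 4 * a) ^ (k - 1) ≤ (-(x - a)) ^ (k - 1) :=
    Real.rpow_le_rpow (by linarith) (by linarith) (by linarith)
  have h₃ := mul_le_mul_of_nonneg_left h₁ hc
  have h₄ := mul_le_mul_of_nonneg_left h₂ hc
  rw [regFn₂, if_pos (by linarith), regFn₁, Real.sign_of_pos (by linarith),
    Real.sign_of_neg (by linarith), abs_of_pos (by linarith : 0 < x),
    abs_of_neg (by linarith : x - a < 0)]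
  linarith

theorem one_le_one_div_one_sub_rpow {k c C : ℝ} (hk : 1 < k) (hc : 0 < c) (hcC : c < C) :
    1 ≤ 1 / (1 - (c / C) ^ (1 / (k - 1))) := by
  have hC : 0 < C := hc.trans hcC
  have hpos : 0 < k - 1 := by linarith
  have h₀ : 0 ≤ (c / C) ^ (1 / (k - 1)) := by positivity
  have h₁ : (c / C) ^ (1 / (k - 1)) < 1 :=
    Real.rpow_lt_one (by positivity) ((div_lt_one hC).2 hcC) (by positivity)
  exact (one_le_div (by linarith)).2 (by linarith)

/-- Two-point separation in the regime `σ ≾ a`: the sup over `w ≥ 0` of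
`|F₁(w) - F₂(w)|` is of order `a^{k-1}`. -/
theorem sup_diff_convolved_orders_small_noise (k c C : ℝ) (hk : 1 < k) (hc : 0 < c)
    (hcC : c < C) :
    ∃ ρ ∈ Set.Ioo (0 : ℝ) 1, ∃ c₁ C₁ : ℝ, 0 < c₁ ∧ c₁ ≤ C₁ ∧
      ∀ a σ : ℝ, 0 < a → 0 < σ → σ ≤ ρ * a →
        c₁ * a ^ (k - 1) ≤
            (⨆ w : Set.Ici (0 : ℝ),
              |unifConv σ (regFn₁ c k) w -
                unifConv σ (regFn₂ c k a (1 / (1 - (c / C) ^ (1 / (k - 1)))) σ) w|) ∧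
        (⨆ w : Set.Ici (0 : ℝ),
            |unifConv σ (regFn₁ c k) w -
              unifConv σ (regFn₂ c k a (1 / (1 - (c / C) ^ (1 / (k - 1)))) σ) w|) ≤
          C₁ * a ^ (k - 1) := by
  have hβ := one_le_one_div_one_sub_rpow hk hc hcC
  set β := 1 / (1 - (c / C) ^ (1 / (k - 1)))
  refine ⟨1 / 4, by norm_num, 2 * c * (1 / 4) ^ (k - 1), 2 * c * (β + 1) ^ (k - 1),
    by positivity, ?_, fun a σ ha hσ hσa => ?_⟩
  · exact mul_le_mul_of_nonneg_left
      (Real.rpow_le_rpow (by norm_num) (by linarith) (by linarith)) (by positivity)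
  have hi₁ := intervalIntegrable_regFn₁ hk hc.le
  have hi₂ := intervalIntegrable_regFn₂ hk hc.le a β σ
  have hupper : ∀ w : Set.Ici (0 : ℝ),
      |unifConv σ (regFn₁ c k) w - unifConv σ (regFn₂ c k a β σ) w| ≤
        2 * c * (β + 1) ^ (k - 1) * a ^ (k - 1) := by
    rintro ⟨w, hw⟩
    rw [Set.mem_Ici] at hw
    rw [unifConv_sub (hi₁ _ _) (hi₂ _ _)]
    exact abs_unifConv_le hσ fun x hx =>
      abs_regFn₁_sub_regFn₂_le hk hc.le ha hβ (by linarith) (by linarith [hx.1])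
  refine ⟨?_, ciSup_le hupper⟩
  refine le_trans ?_ (le_ciSup ⟨_, Set.forall_mem_range.2 hupper⟩
    ⟨a / 2, Set.mem_Ici.2 (by positivity)⟩)
  rw [unifConv_sub (hi₁ _ _) (hi₂ _ _)]
  refine le_trans ?_ (le_abs_self _)
  exact le_unifConv hσ ((hi₁ _ _).sub (hi₂ _ _)) fun x hx =>
    le_regFn₁_sub_regFn₂ hk hc.le ha hβ hσ (by linarith [hx.1]) (by linarith [hx.2])
end

section
/- Fix real k > 1 and 0 < c < C, and let β = 1 / (1 − (c/C)^{1/(k−1)}). There exist constants ρ ∈ (0, 1) and 0 < c₂ ≤ C₂ < ∞, depending only on c, C and k, such that for all a > 0 and σ > 0 with a ≤ ρ·σ, c₂·σ^{k−2}·a ≤ sup_{w ≥ 0} |F₁(w) − F₂(w)| ≤ C₂·σ^{k−2}·a. -/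
open MeasureTheory Real

/-- The integral over `[A, B]` of the increment of a monotone function telescopes to the
difference of its integrals over two intervals of length `a`. -/
lemma Monotone.integral_sub_shift {r : ℝ → ℝ} (hr : Monotone r) (a A B : ℝ) :
    ∫ x in A..B, (r x - r (x - a)) = (∫ x in (B - a)..B, r x) - ∫ x in (A - a)..A, r x := by
  have hi : ∀ u v, IntervalIntegrable r volume u v := fun u v => hr.intervalIntegrable
  have hs : Monotone fun x => r (x - a) := fun x y h => hr (by linarith)
  rw [intervalIntegral.integral_sub (hi _ _) hs.intervalIntegrable,
    intervalIntegral.integral_comp_sub_right]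
  have h1 := intervalIntegral.integral_add_adjacent_intervals (hi A (B - a)) (hi (B - a) B)
  have h2 := intervalIntegral.integral_add_adjacent_intervals (hi (A - a) A) (hi A (B - a))
  linarith

lemma Monotone.integral_le_mul {r : ℝ → ℝ} (hr : Monotone r) {a : ℝ} (ha : 0 ≤ a) (B : ℝ) :
    ∫ x in (B - a)..B, r x ≤ a * r B := by
  calc ∫ x in (B - a)..B, r x ≤ ∫ _ in (B - a)..B, r B :=
        intervalIntegral.integral_mono_on (by linarith) hr.intervalIntegrable
          intervalIntegrable_const fun x hx => hr hx.2
    _ = a * r B := by simp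

lemma Monotone.mul_le_integral {r : ℝ → ℝ} (hr : Monotone r) {a : ℝ} (ha : 0 ≤ a) (B : ℝ) :
    a * r (B - a) ≤ ∫ x in (B - a)..B, r x := by
  calc a * r (B - a) = ∫ _ in (B - a)..B, r (B - a) := by simp
    _ ≤ ∫ x in (B - a)..B, r x :=
        intervalIntegral.integral_mono_on (by linarith) intervalIntegrable_const
          hr.intervalIntegrable fun x hx => hr hx.1

lemma regFn₁_of_nonneg {c k x : ℝ} (hk : 1 < k) (hx : 0 ≤ x) :
    regFn₁ c k x = 1 / 2 + c * x ^ (k - 1) := by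
  rcases hx.eq_or_lt with rfl | hx
  · simp [regFn₁, Real.zero_rpow (by linarith : k - 1 ≠ 0)]
  · simp [regFn₁, Real.sign_of_pos hx, abs_of_pos hx]

lemma regFn₁_neg {c k x : ℝ} (hk : 1 < k) (hx : 0 ≤ x) :
    regFn₁ c k (-x) = 1 / 2 - c * x ^ (k - 1) := by
  rcases hx.eq_or_lt with rfl | hx
  · simp [regFn₁, Real.zero_rpow (by linarith : k - 1 ≠ 0)]
  · simp [regFn₁, Real.sign_of_neg (neg_lt_zero.mpr hx), abs_of_pos hx, sub_eq_add_neg]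

lemma monotone_regFn₁ {c k : ℝ} (hk : 1 < k) (hc : 0 ≤ c) : Monotone (regFn₁ c k) := by
  intro x y hxy
  rcases le_total 0 x with hx | hx
  · rw [regFn₁_of_nonneg hk hx, regFn₁_of_nonneg hk (hx.trans hxy)]
    gcongr
  · obtain ⟨x, rfl⟩ : ∃ z, x = -z := ⟨-x, by simp⟩
    have hx' : 0 ≤ x := by linarith
    rw [regFn₁_neg hk hx']
    rcases le_total 0 y with hy | hy
    · rw [regFn₁_of_nonneg hk hy]
      have h1 : 0 ≤ c * x ^ (k - 1) := by positivity
      have h2 : 0 ≤ c * y ^ (k - 1) := by positivity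
      linarith
    · obtain ⟨y, rfl⟩ : ∃ z, y = -z := ⟨-y, by simp⟩
      rw [regFn₁_neg hk (by linarith)]
      gcongr <;> linarith

lemma regFn₂_eq_sub_indicator (c k a β σ : ℝ) :
    regFn₂ c k a β σ = fun x => regFn₁ c k x -
      (Set.Iio (β * a + σ)).indicator (fun x => regFn₁ c k x - regFn₁ c k (x - a)) x := by
  ext x
  by_cases h : x < β * a + σ
  · simp [regFn₂, h, regFn₁]
    ring
  · simp [regFn₂, h]

lemma unifConv_regFn₁_sub_regFn₂ {c k : ℝ} (hk : 1 < k) (hc : 0 ≤ c) (a β σ w : ℝ) :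
    unifConv σ (regFn₁ c k) w - unifConv σ (regFn₂ c k a β σ) w =
      (1 / (2 * σ)) * ∫ x in (w - σ)..(w + σ),
        (Set.Iio (β * a + σ)).indicator (fun x => regFn₁ c k x - regFn₁ c k (x - a)) x := by
  have hr := monotone_regFn₁ hk hc
  have hs : Monotone fun x => regFn₁ c k (x - a) := fun x y h => hr (by linarith)
  have hd : IntervalIntegrable (fun x => regFn₁ c k x - regFn₁ c k (x - a)) volume
      (w - σ) (w + σ) := hr.intervalIntegrable.sub hs.intervalIntegrable
  have hi : IntervalIntegrable ((Set.Iio (β * a + σ)).indicator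
      (fun x => regFn₁ c k x - regFn₁ c k (x - a))) volume (w - σ) (w + σ) :=
    ⟨hd.1.indicator measurableSet_Iio, hd.2.indicator measurableSet_Iio⟩
  rw [regFn₂_eq_sub_indicator, unifConv, unifConv,
    intervalIntegral.integral_sub hr.intervalIntegrable hi]
  ring

lemma unifConv_regFn₁_sub_regFn₂_nonneg {c k a σ : ℝ} (hk : 1 < k) (hc : 0 ≤ c) (ha : 0 ≤ a)
    (hσ : 0 ≤ σ) (β w : ℝ) :
    0 ≤ unifConv σ (regFn₁ c k) w - unifConv σ (regFn₂ c k a β σ) w := by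
  rw [unifConv_regFn₁_sub_regFn₂ hk hc]
  refine mul_nonneg (by positivity) (intervalIntegral.integral_nonneg (by linarith) fun x _ => ?_)
  exact Set.indicator_nonneg
    (fun y _ => sub_nonneg.mpr (monotone_regFn₁ hk hc (by linarith))) x

lemma unifConv_regFn₁_sub_regFn₂_le {c k a β σ w : ℝ} (hk : 1 < k) (hc : 0 ≤ c) (ha : 0 ≤ a)
    (hβ : 0 ≤ β) (hσ : 0 ≤ σ) (hw : 0 ≤ w) :
    unifConv σ (regFn₁ c k) w - unifConv σ (regFn₂ c k a β σ) w ≤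
      (1 / (2 * σ)) * (a * (c * (β * a + σ) ^ (k - 1) + c * (σ + a) ^ (k - 1))) := by
  have hr := monotone_regFn₁ hk hc
  have hs : Monotone fun x => regFn₁ c k (x - a) := fun x y h => hr (by linarith)
  have hβa : 0 ≤ β * a := by positivity
  rw [unifConv_regFn₁_sub_regFn₂ hk hc]
  refine mul_le_mul_of_nonneg_left ?_ (by positivity)
  calc _ ≤ ∫ x in (-σ)..(β * a + σ), (regFn₁ c k x - regFn₁ c k (x - a)) := by
        rw [intervalIntegral.integral_of_le (by linarith),
          intervalIntegral.integral_of_le (by linarith), setIntegral_indicator measurableSet_Iio]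
        refine setIntegral_mono_set (hr.intervalIntegrable.sub hs.intervalIntegrable).1
          (Filter.Eventually.of_forall fun x => sub_nonneg.mpr (hr (by linarith)))
          (Filter.Eventually.of_forall fun x hx => ?_)
        exact ⟨by linarith [hx.1.1], le_of_lt hx.2⟩
    _ ≤ a * regFn₁ c k (β * a + σ) - a * regFn₁ c k (-σ - a) := by
        rw [hr.integral_sub_shift]
        exact sub_le_sub (hr.integral_le_mul ha _) (hr.mul_le_integral ha _)
    _ = _ := by
        rw [regFn₁_of_nonneg hk (by linarith), show -σ - a = -(σ + a) by ring,
          regFn₁_neg hk (by linarith)]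
        ring

lemma le_unifConv_regFn₁_sub_regFn₂_zero {c k a β σ : ℝ} (hk : 1 < k) (hc : 0 ≤ c) (ha : 0 < a)
    (hβ : 0 < β) (haσ : a ≤ σ) :
    (1 / (2 * σ)) * (a * (c * σ ^ (k - 1))) ≤
      unifConv σ (regFn₁ c k) 0 - unifConv σ (regFn₂ c k a β σ) 0 := by
  have hr := monotone_regFn₁ hk hc
  have hσ : 0 < σ := ha.trans_le haσ
  have hβa : 0 < β * a := by positivity
  rw [unifConv_regFn₁_sub_regFn₂ hk hc]
  refine mul_le_mul_of_nonneg_left ?_ (by positivity)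
  have hpos : 0 ≤ c * (σ - a) ^ (k - 1) :=
    mul_nonneg hc (Real.rpow_nonneg (by linarith) _)
  calc a * (c * σ ^ (k - 1)) ≤ a * regFn₁ c k (σ - a) - a * regFn₁ c k (-σ) := by
        rw [regFn₁_of_nonneg hk (by linarith), regFn₁_neg hk hσ.le]
        nlinarith
    _ ≤ ∫ x in (-σ)..σ, (regFn₁ c k x - regFn₁ c k (x - a)) := by
        rw [hr.integral_sub_shift]
        exact sub_le_sub (hr.mul_le_integral ha.le _) (hr.integral_le_mul ha.le _)
    _ = _ := by
        rw [zero_sub, zero_add]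
        refine intervalIntegral.integral_congr fun x hx => ?_
        rw [Set.uIcc_of_le (by linarith)] at hx
        have hx' : x ∈ Set.Iio (β * a + σ) := Set.mem_Iio.mpr (by linarith [hx.2])
        simp only [Set.indicator_of_mem hx']

/-- Two-point separation in the regime `a ≾ σ`: the sup over `w ≥ 0` of
`|F₁(w) - F₂(w)|` is of order `σ^{k-2}·a`. -/
theorem sup_diff_convolved_orders_large_noise (k c C : ℝ) (hk : 1 < k) (hc : 0 < c)
    (hcC : c < C) :
    ∃ ρ ∈ Set.Ioo (0 : ℝ) 1, ∃ c₂ C₂ : ℝ, 0 < c₂ ∧ c₂ ≤ C₂ ∧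
      ∀ a σ : ℝ, 0 < a → 0 < σ → a ≤ ρ * σ →
        c₂ * σ ^ (k - 2) * a ≤
            (⨆ w : Set.Ici (0 : ℝ),
              |unifConv σ (regFn₁ c k) w -
                unifConv σ (regFn₂ c k a (1 / (1 - (c / C) ^ (1 / (k - 1)))) σ) w|) ∧
        (⨆ w : Set.Ici (0 : ℝ),
            |unifConv σ (regFn₁ c k) w -
              unifConv σ (regFn₂ c k a (1 / (1 - (c / C) ^ (1 / (k - 1)))) σ) w|) ≤
          C₂ * σ ^ (k - 2) * a := by
  have hβ : (0 : ℝ) < 1 / (1 - (c / C) ^ (1 / (k - 1))) := by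
    have h := Real.rpow_lt_one (div_nonneg hc.le (hc.trans hcC).le)
      ((div_lt_one (hc.trans hcC)).mpr hcC) (one_div_pos.mpr (sub_pos.mpr hk))
    exact one_div_pos.mpr (sub_pos.mpr h)
  generalize 1 / (1 - (c / C) ^ (1 / (k - 1))) = β at hβ
  have h1 : (1 : ℝ) ≤ (β + 1) ^ (k - 1) := Real.one_le_rpow (by linarith) (by linarith)
  have h2 : (0 : ℝ) ≤ 2 ^ (k - 1) := by positivity
  refine ⟨1 / 2, by norm_num, c / 2, c / 2 * ((β + 1) ^ (k - 1) + 2 ^ (k - 1)), by positivity,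
    le_mul_of_one_le_right (by positivity) (by linarith), fun a σ ha hσ haσ => ?_⟩
  have hpow : σ ^ (k - 1) = σ ^ (k - 2) * σ := by
    rw [← Real.rpow_add_one hσ.ne']
    ring_nf
  have hle : ∀ w : Set.Ici (0 : ℝ),
      |unifConv σ (regFn₁ c k) w - unifConv σ (regFn₂ c k a β σ) w| ≤
        c / 2 * ((β + 1) ^ (k - 1) + 2 ^ (k - 1)) * σ ^ (k - 2) * a := by
    intro w
    rw [abs_of_nonneg (unifConv_regFn₁_sub_regFn₂_nonneg hk hc.le ha.le hσ.le β w)]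
    calc _ ≤ (1 / (2 * σ)) * (a * (c * (β * a + σ) ^ (k - 1) + c * (σ + a) ^ (k - 1))) :=
          unifConv_regFn₁_sub_regFn₂_le hk hc.le ha.le hβ.le hσ.le w.2
      _ ≤ (1 / (2 * σ)) * (a * (c * ((β + 1) * σ) ^ (k - 1) + c * (2 * σ) ^ (k - 1))) := by
          gcongr <;> nlinarith
      _ = _ := by
          rw [Real.mul_rpow (by positivity) hσ.le, Real.mul_rpow (by positivity) hσ.le, hpow]
          field_simp
  refine ⟨?_, ciSup_le hle⟩
  refine le_ciSup_of_le ⟨_, Set.forall_mem_range.mpr hle⟩ ⟨(0 : ℝ), Set.self_mem_Ici⟩ ?_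
  calc c / 2 * σ ^ (k - 2) * a = (1 / (2 * σ)) * (a * (c * σ ^ (k - 1))) := by
        rw [hpow]
        field_simp
    _ ≤ _ := (le_unifConv_regFn₁_sub_regFn₂_zero hk hc.le ha hβ (by linarith)).trans (le_abs_self _)
end

section
/- Let n ≥ 1, let (S₁, …, S_n) be an active strategy with budget n, and let F₀, F₁ : [−1,1] → (0,1) be measurable. Then the Kullback–Leibler divergence between the induced joint laws of the query–label sequence satisfies KL(P^{F₁}_n ‖ P^{F₀}_n) ≤ n · sup_{w ∈ [−1,1]} kl(F₁(w), F₀(w)). -/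
open MeasureTheory Real
open scoped ENNReal Classical

/-- The Bernoulli measure with parameter `p` on `Bool`. -/
noncomputable def bern (p : ℝ) : Measure Bool :=
  ENNReal.ofReal p • Measure.dirac true + ENNReal.ofReal (1 - p) • Measure.dirac false

/-- The law `P^F_n` of the query–label sequence `(W₁,Y₁,…,W_n,Y_n)` induced by an
active strategy `S` and regression function `F`: `W_i = S_i(W₁,Y₁,…,W_{i-1},Y_{i-1})`
and, conditionally on the history, `Y_i` is `Bernoulli(F(W_i))`. -/
noncomputable def activeLaw (F : ℝ → ℝ) :
    (n : ℕ) → ((i : Fin n) → (Fin i → ℝ × Bool) → ℝ) → Measure (Fin n → ℝ × Bool)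
  | 0, _ => Measure.dirac (fun i => i.elim0)
  | n + 1, S =>
    (activeLaw F n (fun i h => S i.castSucc h)).bind
      (fun hist =>
        (bern (F (S (Fin.last n) hist))).map
          (fun y => Fin.snoc hist (S (Fin.last n) hist, y)))

open ProbabilityTheory InformationTheory in
theorem KLdiv_eq_klDiv {Ω : Type*} [MeasurableSpace Ω] (P Q : Measure Ω)
    [IsProbabilityMeasure P] [IsProbabilityMeasure Q] : KLdiv P Q = klDiv P Q := by
  rw [KLdiv, klDiv_def]
  simp [llr_def]

theorem isProbabilityMeasure_bern {p : ℝ} (hp : p ∈ Set.Ioo (0 : ℝ) 1) :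
    IsProbabilityMeasure (bern p) := by
  constructor
  simp only [bern, Measure.add_apply, Measure.smul_apply, measure_univ, smul_eq_mul, mul_one]
  rw [← ENNReal.ofReal_add hp.1.le (by linarith [hp.2])]
  simp

theorem measurable_bern : Measurable bern := by
  refine Measure.measurable_of_measurable_coe _ fun s _ => ?_
  simp only [bern, Measure.add_apply, Measure.smul_apply, smul_eq_mul]
  fun_prop

theorem lintegral_bern (p : ℝ) (f : Bool → ℝ≥0∞) :
    ∫⁻ y, f y ∂(bern p) = ENNReal.ofReal p * f true + ENNReal.ofReal (1 - p) * f false := by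
  simp [bern, lintegral_add_measure, lintegral_smul_measure]

/-- The likelihood ratio of `Bernoulli(p)` with respect to `Bernoulli(q)`. -/
noncomputable def bernRatio (p q : ℝ) (y : Bool) : ℝ :=
  if y = true then p / q else (1 - p) / (1 - q)

theorem bernRatio_nonneg {p q : ℝ} (hp : p ∈ Set.Ioo (0 : ℝ) 1) (hq : q ∈ Set.Ioo (0 : ℝ) 1)
    (y : Bool) : 0 ≤ bernRatio p q y := by
  obtain ⟨hp0, hp1⟩ := hp
  obtain ⟨hq0, hq1⟩ := hq
  unfold bernRatio
  split_ifs
  · positivity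
  · exact div_nonneg (by linarith) (by linarith)

theorem bern_eq_withDensity {p q : ℝ} (hp : p ∈ Set.Ioo (0 : ℝ) 1) (hq : q ∈ Set.Ioo (0 : ℝ) 1) :
    bern p = (bern q).withDensity (fun y => ENNReal.ofReal (bernRatio p q y)) := by
  obtain ⟨hp0, hp1⟩ := hp
  obtain ⟨hq0, hq1⟩ := hq
  ext s hs
  rw [withDensity_apply _ hs, ← lintegral_indicator hs, lintegral_bern, ← lintegral_indicator_one hs,
    lintegral_bern]
  have e1 : ENNReal.ofReal q * ENNReal.ofReal (bernRatio p q true) = ENNReal.ofReal p := by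
    rw [← ENNReal.ofReal_mul hq0.le]
    congr 1
    simp only [bernRatio, if_true]
    field_simp
  have e2 : ENNReal.ofReal (1 - q) * ENNReal.ofReal (bernRatio p q false) =
      ENNReal.ofReal (1 - p) := by
    rw [← ENNReal.ofReal_mul (by linarith)]
    congr 1
    have : 1 - q ≠ 0 := by linarith
    simp only [bernRatio, Bool.false_eq_true, if_false]
    field_simp
  by_cases ht : true ∈ s <;> by_cases hf : false ∈ s <;> simp [ht, hf, e1, e2]

open InformationTheory in
theorem lintegral_klFun_bernRatio {p q : ℝ} (hp : p ∈ Set.Ioo (0 : ℝ) 1)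
    (hq : q ∈ Set.Ioo (0 : ℝ) 1) :
    ∫⁻ y, ENNReal.ofReal (klFun (bernRatio p q y)) ∂(bern q) = ENNReal.ofReal (klBer p q) := by
  rw [lintegral_bern, ← ENNReal.ofReal_mul hq.1.le, ← ENNReal.ofReal_mul (by linarith [hq.2]),
    ← ENNReal.ofReal_add
      (mul_nonneg hq.1.le (klFun_nonneg (bernRatio_nonneg hp hq _)))
      (mul_nonneg (by linarith [hq.2]) (klFun_nonneg (bernRatio_nonneg hp hq _)))]
  congr 1
  have hq0 : q ≠ 0 := hq.1.ne'
  have hq1 : 1 - q ≠ 0 := by linarith [hq.2]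
  simp only [bernRatio, klFun_apply, klBer, if_true, Bool.false_eq_true, if_false]
  generalize log (p / q) = a
  generalize log ((1 - p) / (1 - q)) = b
  field_simp
  ring

section Kernel

open ProbabilityTheory InformationTheory

variable {α : Type*} [MeasurableSpace α]

/-- The kernel `a ↦ Bernoulli(p a)`. -/
noncomputable def bernKernel (p : α → ℝ) (hp : Measurable p) : Kernel α Bool where
  toFun a := bern (p a)
  measurable' := measurable_bern.comp hp

theorem isMarkovKernel_bernKernel {p : α → ℝ} (hp : Measurable p)
    (h : ∀ a, p a ∈ Set.Ioo (0 : ℝ) 1) : IsMarkovKernel (bernKernel p hp) :=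
  ⟨fun a => isProbabilityMeasure_bern (h a)⟩

/-- The conditional Kullback–Leibler divergence of two Bernoulli kernels. -/
theorem klDiv_compProd_bernKernel (μ : Measure α) [IsFiniteMeasure μ] {p q : α → ℝ}
    (hp : Measurable p) (hq : Measurable q) (hp' : ∀ a, p a ∈ Set.Ioo (0 : ℝ) 1)
    (hq' : ∀ a, q a ∈ Set.Ioo (0 : ℝ) 1) :
    klDiv (μ.compProd (bernKernel p hp)) (μ.compProd (bernKernel q hq)) =
      ∫⁻ a, ENNReal.ofReal (klBer (p a) (q a)) ∂μ := by
  have := isMarkovKernel_bernKernel hp hp'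
  have := isMarkovKernel_bernKernel hq hq'
  have hr : Measurable (fun x : α × Bool => bernRatio (p x.1) (q x.1) x.2) :=
    Measurable.ite (measurable_snd (measurableSet_singleton true)) (by fun_prop) (by fun_prop)
  have hker : bernKernel p hp = (bernKernel q hq).withDensity
      (fun a y => ENNReal.ofReal (bernRatio (p a) (q a) y)) := by
    ext1 a
    rw [Kernel.withDensity_apply _ hr.ennreal_ofReal]
    exact bern_eq_withDensity (hp' a) (hq' a)
  have hdens : μ.compProd (bernKernel p hp) = (μ.compProd (bernKernel q hq)).withDensity
      (fun x => ENNReal.ofReal (bernRatio (p x.1) (q x.1) x.2)) := by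
    have hk : IsSFiniteKernel ((bernKernel q hq).withDensity
        (fun a y => ENNReal.ofReal (bernRatio (p a) (q a) y))) := by
      rw [← hker]; infer_instance
    rw [hker]
    exact Measure.compProd_withDensity hr.ennreal_ofReal
  have hac : μ.compProd (bernKernel p hp) ≪ μ.compProd (bernKernel q hq) := by
    rw [hdens]
    exact withDensity_absolutelyContinuous _ _
  rw [klDiv_eq_lintegral_klFun_of_ac hac]
  have hrn := Measure.rnDeriv_withDensity (μ.compProd (bernKernel q hq)) hr.ennreal_ofReal
  rw [← hdens] at hrn
  calc _ = ∫⁻ x, ENNReal.ofReal (klFun (bernRatio (p x.1) (q x.1) x.2))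
          ∂(μ.compProd (bernKernel q hq)) := by
        refine lintegral_congr_ae ?_
        filter_upwards [hrn] with x hx
        rw [hx, ENNReal.toReal_ofReal (bernRatio_nonneg (hp' _) (hq' _) _)]
    _ = ∫⁻ a, ∫⁻ y, ENNReal.ofReal (klFun (bernRatio (p a) (q a) y)) ∂(bern (q a)) ∂μ :=
        Measure.lintegral_compProd (measurable_klFun.comp hr).ennreal_ofReal
    _ = _ := lintegral_congr fun a => lintegral_klFun_bernRatio (hp' a) (hq' a)

theorem bind_map_bern_eq_map_compProd {β : Type*} [MeasurableSpace β] (μ : Measure α) [SFinite μ]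
    {p : α → ℝ} (hp : Measurable p) (hp' : ∀ a, p a ∈ Set.Ioo (0 : ℝ) 1) {g : α × Bool → β}
    (hg : Measurable g) :
    μ.bind (fun a => (bern (p a)).map (fun y => g (a, y))) =
      (μ.compProd (bernKernel p hp)).map g := by
  have := isMarkovKernel_bernKernel hp hp'
  have hval (a : α) {s : Set β} (hs : MeasurableSet s) :
      (bern (p a)).map (fun y => g (a, y)) s =
        bernKernel p hp a (Prod.mk a ⁻¹' (g ⁻¹' s)) :=
    Measure.map_apply (hg.comp measurable_prodMk_left) hs
  have hm : Measurable (fun a => (bern (p a)).map (fun y => g (a, y))) := by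
    refine Measure.measurable_of_measurable_coe _ fun s hs => ?_
    simp_rw [hval _ hs]
    exact Kernel.measurable_kernel_prodMk_left (hg hs)
  ext s hs
  rw [Measure.bind_apply hs hm.aemeasurable, Measure.map_apply hg hs,
    Measure.compProd_apply (hg hs)]
  exact lintegral_congr fun a => hval a hs

end Kernel

theorem measurable_snoc_query {n : ℕ} {s : (Fin n → ℝ × Bool) → ℝ} (hs : Measurable s) :
    Measurable (fun x : (Fin n → ℝ × Bool) × Bool =>
      (Fin.snoc x.1 (s x.1, x.2) : Fin (n + 1) → ℝ × Bool)) := by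
  refine measurable_pi_iff.2 fun i => ?_
  induction i using Fin.lastCases with
  | last => simp only [Fin.snoc_last]; fun_prop
  | cast i => simp only [Fin.snoc_castSucc]; fun_prop

theorem activeLaw_succ (F : ℝ → ℝ) (hF : Measurable F)
    (hF' : ∀ w ∈ Set.Icc (-1 : ℝ) 1, F w ∈ Set.Ioo (0 : ℝ) 1) (n : ℕ)
    (S : (i : Fin (n + 1)) → (Fin i → ℝ × Bool) → ℝ) {s : (Fin n → ℝ × Bool) → ℝ}
    (hSs : S (Fin.last n) = s) (hs : Measurable s) (hs' : ∀ h, s h ∈ Set.Icc (-1 : ℝ) 1)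
    [SFinite (activeLaw F n (fun i h => S i.castSucc h))] :
    activeLaw F (n + 1) S =
      ((activeLaw F n (fun i h => S i.castSucc h)).compProd
        (bernKernel (F ∘ s) (hF.comp hs))).map (fun x => Fin.snoc x.1 (s x.1, x.2)) := by
  rw [activeLaw, ← bind_map_bern_eq_map_compProd _ (hF.comp hs) (fun h => hF' _ (hs' h))
    (measurable_snoc_query hs), ← hSs]
  rfl

theorem isProbabilityMeasure_activeLaw (F : ℝ → ℝ) (hF : Measurable F)
    (hF' : ∀ w ∈ Set.Icc (-1 : ℝ) 1, F w ∈ Set.Ioo (0 : ℝ) 1) (n : ℕ)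
    (S : (i : Fin n) → (Fin i → ℝ × Bool) → ℝ) (hS : ∀ i, Measurable (S i))
    (hS' : ∀ (i : Fin n) (h : Fin i → ℝ × Bool), S i h ∈ Set.Icc (-1 : ℝ) 1) :
    IsProbabilityMeasure (activeLaw F n S) := by
  induction n with
  | zero => exact inferInstanceAs (IsProbabilityMeasure (Measure.dirac _))
  | succ n ih =>
    have := ih (fun i h => S i.castSucc h) (fun i => hS i.castSucc) (fun i => hS' i.castSucc)
    obtain ⟨s, hSs⟩ : ∃ s : (Fin n → ℝ × Bool) → ℝ, S (Fin.last n) = s := ⟨_, rfl⟩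
    have hs : Measurable s := hSs ▸ hS (Fin.last n)
    have hs' : ∀ h, s h ∈ Set.Icc (-1 : ℝ) 1 := hSs ▸ hS' (Fin.last n)
    rw [activeLaw_succ F hF hF' n S hSs hs hs']
    have := isMarkovKernel_bernKernel (hF.comp hs) (fun h => hF' _ (hs' h))
    exact Measure.isProbabilityMeasure_map (measurable_snoc_query hs).aemeasurable

open InformationTheory in
theorem klDiv_activeLaw_le_mul_iSup (F₀ F₁ : ℝ → ℝ) (h₀meas : Measurable F₀)
    (h₁meas : Measurable F₁)
    (h₀ : ∀ w ∈ Set.Icc (-1 : ℝ) 1, F₀ w ∈ Set.Ioo (0 : ℝ) 1)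
    (h₁ : ∀ w ∈ Set.Icc (-1 : ℝ) 1, F₁ w ∈ Set.Ioo (0 : ℝ) 1) (n : ℕ)
    (S : (i : Fin n) → (Fin i → ℝ × Bool) → ℝ) (hS : ∀ i, Measurable (S i))
    (hS' : ∀ (i : Fin n) (h : Fin i → ℝ × Bool), S i h ∈ Set.Icc (-1 : ℝ) 1) :
    klDiv (activeLaw F₁ n S) (activeLaw F₀ n S) ≤
      (n : ℝ≥0∞) * ⨆ w : Set.Icc (-1 : ℝ) 1, ENNReal.ofReal (klBer (F₁ w) (F₀ w)) := by
  induction n with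
  | zero =>
    refine le_of_eq ?_
    rw [Nat.cast_zero, zero_mul]
    exact klDiv_self (Measure.dirac _)
  | succ n ih =>
    have hSn : ∀ i : Fin n, Measurable (S i.castSucc) := fun i => hS i.castSucc
    have hSn' := fun i : Fin n => hS' i.castSucc
    have ihn := ih (fun i h => S i.castSucc h) hSn hSn'
    have := isProbabilityMeasure_activeLaw F₀ h₀meas h₀ n (fun i h => S i.castSucc h) hSn hSn'
    have := isProbabilityMeasure_activeLaw F₁ h₁meas h₁ n (fun i h => S i.castSucc h) hSn hSn'
    obtain ⟨s, hSs⟩ : ∃ s : (Fin n → ℝ × Bool) → ℝ, S (Fin.last n) = s := ⟨_, rfl⟩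
    have hs : Measurable s := hSs ▸ hS (Fin.last n)
    have hs' : ∀ h, s h ∈ Set.Icc (-1 : ℝ) 1 := hSs ▸ hS' (Fin.last n)
    have hlast₀ := fun h => h₀ _ (hs' h)
    have hlast₁ := fun h => h₁ _ (hs' h)
    have := isMarkovKernel_bernKernel (h₀meas.comp hs) hlast₀
    have := isMarkovKernel_bernKernel (h₁meas.comp hs) hlast₁
    rw [activeLaw_succ F₀ h₀meas h₀ n S hSs hs hs', activeLaw_succ F₁ h₁meas h₁ n S hSs hs hs']
    refine (klDiv_map_le _ _ (measurable_snoc_query hs)).trans ?_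
    rw [klDiv_compProd_eq_add, Nat.cast_succ, add_mul, one_mul]
    refine add_le_add ihn ?_
    rw [klDiv_compProd_bernKernel _ (h₁meas.comp hs) (h₀meas.comp hs) hlast₁ hlast₀]
    refine (lintegral_mono fun h => le_iSup
      (fun w : Set.Icc (-1 : ℝ) 1 => ENNReal.ofReal (klBer (F₁ w) (F₀ w)))
      ⟨s h, hs' h⟩).trans_eq ?_
    simp

/-- KL divergence bound for active strategies:
`KL(P^{F₁}_n ‖ P^{F₀}_n) ≤ n · sup_{w ∈ [-1,1]} kl(F₁(w), F₀(w))`. -/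
theorem klDiv_activeLaw_le (n : ℕ) (hn : 1 ≤ n)
    (S : (i : Fin n) → (Fin i → ℝ × Bool) → ℝ)
    (hSmeas : ∀ i, Measurable (S i))
    (hSrange : ∀ (i : Fin n) (h : Fin i → ℝ × Bool), S i h ∈ Set.Icc (-1 : ℝ) 1)
    (F₀ F₁ : ℝ → ℝ) (h₀meas : Measurable F₀) (h₁meas : Measurable F₁)
    (h₀ : ∀ w ∈ Set.Icc (-1 : ℝ) 1, F₀ w ∈ Set.Ioo (0 : ℝ) 1)
    (h₁ : ∀ w ∈ Set.Icc (-1 : ℝ) 1, F₁ w ∈ Set.Ioo (0 : ℝ) 1) :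
    KLdiv (activeLaw F₁ n S) (activeLaw F₀ n S) ≤
      (n : ℝ≥0∞) * ⨆ w : Set.Icc (-1 : ℝ) 1, ENNReal.ofReal (klBer (F₁ w) (F₀ w)) := by
  have := isProbabilityMeasure_activeLaw F₀ h₀meas h₀ n S hSmeas hSrange
  have := isProbabilityMeasure_activeLaw F₁ h₁meas h₁ n S hSmeas hSrange
  rw [KLdiv_eq_klDiv]
  exact klDiv_activeLaw_le_mul_iSup F₀ F₁ h₀meas h₁meas h₀ h₁ n S hSmeas hSrange
end

section
/- (Passive minimax lower bound, k = 1, large noise.) Fix c ∈ (0, 1/4]. There exist constants κ₀ ≥ 1 and κ₁ > 0, depending only on c, such that for every integer n ≥ 1, every σ with κ₀/n ≤ σ ≤ 1/2, and every measurable estimator t̂ : ([−1,1] × {0,1})^n → ℝ, one has sup_{t ∈ [−1/2, 1/2]} E_{μ_{F_t}^{⊗n}} |t̂ − t| ≥ κ₁ √(σ/n), where the expectation is over n i.i.d. samples (W_i, Y_i) from μ_{F_t}. -/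
open MeasureTheory Real
open scoped ENNReal

/-- The law `μ_F` of a passive sample `(W, Y)`: `W` is uniform on `[-1,1]` and,
conditionally on `W = w`, `Y` is `Bernoulli(F(w))`. -/
noncomputable def sampleLaw (F : ℝ → ℝ) : Measure (ℝ × Bool) :=
  ((2 : ℝ≥0∞)⁻¹ • (volume.restrict (Set.Icc (-1 : ℝ) 1))).bind
    (fun w => (bern (F w)).map (Prod.mk w))

lemma lintegral_pi_prod {ι α : Type*} [Fintype ι] [MeasurableSpace α] (μ : Measure α)
    [IsProbabilityMeasure μ] {g : ι → α → ℝ≥0∞} (hg : ∀ i, Measurable (g i)) :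
    ∫⁻ x, ∏ i, g i (x i) ∂(Measure.pi fun _ : ι => μ) = ∏ i, ∫⁻ a, g i a ∂μ := by
  have hind : ProbabilityTheory.iIndepFun (fun i (x : ι → α) => g i (x i))
      (Measure.pi fun _ : ι => μ) :=
    ProbabilityTheory.iIndepFun_pi (μ := fun _ : ι => μ) fun i => (hg i).aemeasurable
  rw [ProbabilityTheory.lintegral_prod_eq_prod_lintegral_of_indepFun Finset.univ _ hind
    fun i => (hg i).comp (measurable_pi_apply i)]
  refine Finset.prod_congr rfl fun i _ => ?_
  exact (measurePreserving_eval (fun _ : ι => μ) i).lintegral_comp (hg i)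

lemma pi_withDensity {ι α : Type*} [Fintype ι] [MeasurableSpace α] (μ : Measure α)
    [IsProbabilityMeasure μ] {r : α → ℝ≥0∞} (hr : Measurable r)
    [IsProbabilityMeasure (μ.withDensity r)] :
    (Measure.pi fun _ : ι => μ.withDensity r) =
      (Measure.pi fun _ : ι => μ).withDensity fun x => ∏ i, r (x i) := by
  refine Measure.pi_eq fun s hs => ?_
  rw [withDensity_apply _ (MeasurableSet.univ_pi hs),
    ← lintegral_indicator (MeasurableSet.univ_pi hs)]
  have hpt : (Set.univ.pi s).indicator (fun x : ι → α => ∏ i, r (x i)) =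
      fun x => ∏ i, (s i).indicator r (x i) := by
    ext x
    by_cases hx : x ∈ Set.univ.pi s
    · rw [Set.indicator_of_mem hx]
      exact Finset.prod_congr rfl fun i _ =>
        (Set.indicator_of_mem (hx i (Set.mem_univ i)) r).symm
    · rw [Set.indicator_of_notMem hx]
      obtain ⟨i, hi⟩ : ∃ i, x i ∉ s i := by simpa [Set.mem_pi] using hx
      exact (Finset.prod_eq_zero (Finset.mem_univ i) (Set.indicator_of_notMem hi r)).symm
  rw [hpt, lintegral_pi_prod μ fun i => hr.indicator (hs i)]
  refine Finset.prod_congr rfl fun i _ => ?_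
  rw [lintegral_indicator (hs i), withDensity_apply _ (hs i)]

lemma measurable_bern_map {F : ℝ → ℝ} (hF : Measurable F) :
    Measurable fun w => (bern (F w)).map (Prod.mk w) := by
  refine Measure.measurable_of_measurable_coe _ fun s hs => ?_
  have happly : ∀ w, (bern (F w)).map (Prod.mk w) s =
      ENNReal.ofReal (F w) * s.indicator 1 (w, true) +
        ENNReal.ofReal (1 - F w) * s.indicator 1 (w, false) := by
    intro w
    rw [Measure.map_apply measurable_prodMk_left hs]
    simp [bern, Set.indicator]
    rfl
  simp_rw [happly]
  have hind : Measurable (s.indicator (1 : ℝ × Bool → ℝ≥0∞)) := measurable_one.indicator hs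
  fun_prop

lemma lintegral_sampleLaw {F : ℝ → ℝ} (hF : Measurable F) {g : ℝ × Bool → ℝ≥0∞}
    (hg : Measurable g) :
    ∫⁻ x, g x ∂sampleLaw F = 2⁻¹ * ∫⁻ w in Set.Icc (-1 : ℝ) 1,
      (ENNReal.ofReal (F w) * g (w, true) + ENNReal.ofReal (1 - F w) * g (w, false)) := by
  rw [sampleLaw, Measure.lintegral_bind (measurable_bern_map hF).aemeasurable hg.aemeasurable,
    lintegral_smul_measure, smul_eq_mul]
  congr 1
  refine lintegral_congr fun w => ?_
  rw [lintegral_map hg measurable_prodMk_left, bern, lintegral_add_measure,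
    lintegral_smul_measure, lintegral_smul_measure, lintegral_dirac, lintegral_dirac]
  rfl

lemma isProbabilityMeasure_sampleLaw {F : ℝ → ℝ} (hF : Measurable F) (h0 : ∀ w, 0 ≤ F w)
    (h1 : ∀ w, F w ≤ 1) : IsProbabilityMeasure (sampleLaw F) := by
  constructor
  rw [← lintegral_one, lintegral_sampleLaw hF measurable_const]
  have hsum : ∀ w, ENNReal.ofReal (F w) * 1 + ENNReal.ofReal (1 - F w) * 1 = 1 := by
    intro w
    rw [mul_one, mul_one, ← ENNReal.ofReal_add (h0 w) (by linarith [h1 w])]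
    simp
  simp only [hsum]
  rw [lintegral_one, Measure.restrict_apply_univ, Real.volume_Icc]
  norm_num
  exact ENNReal.inv_mul_cancel (by norm_num) (by norm_num)

/-- Likelihood ratio of `sampleLaw G` with respect to `sampleLaw F`. -/
noncomputable def likelihoodRatio (F G : ℝ → ℝ) (x : ℝ × Bool) : ℝ≥0∞ :=
  ENNReal.ofReal (if x.2 = true then G x.1 / F x.1 else (1 - G x.1) / (1 - F x.1))

lemma measurable_likelihoodRatio {F G : ℝ → ℝ} (hF : Measurable F) (hG : Measurable G) :
    Measurable (likelihoodRatio F G) := by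
  refine ENNReal.measurable_ofReal.comp (Measurable.ite ?_ (by fun_prop) (by fun_prop))
  exact measurable_snd (measurableSet_singleton true)

lemma sampleLaw_eq_withDensity {F G : ℝ → ℝ} (hF : Measurable F) (hG : Measurable G)
    (h0 : ∀ w, 0 < F w) (h1 : ∀ w, F w < 1) :
    sampleLaw G = (sampleLaw F).withDensity (likelihoodRatio F G) := by
  have hr := measurable_likelihoodRatio hF hG
  ext s hs
  have hind : Measurable (s.indicator (1 : ℝ × Bool → ℝ≥0∞)) := measurable_one.indicator hs
  rw [← lintegral_indicator_one hs, ← lintegral_indicator_one hs,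
    lintegral_withDensity_eq_lintegral_mul _ hr hind, lintegral_sampleLaw hG hind,
    lintegral_sampleLaw hF (hr.mul hind)]
  congr 1
  refine lintegral_congr fun w => ?_
  have h0w := h0 w
  have h1w := sub_pos.2 (h1 w)
  simp only [Pi.mul_apply, likelihoodRatio, if_true, Bool.false_eq_true, if_false]
  rw [← mul_assoc, ← mul_assoc, ← ENNReal.ofReal_mul h0w.le, ← ENNReal.ofReal_mul h1w.le,
    mul_div_cancel₀ _ h0w.ne', mul_div_cancel₀ _ h1w.ne']

lemma bernoulli_chiSq_le {p q : ℝ} (hp : p ∈ Set.Icc (1 / 4 : ℝ) (3 / 4)) :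
    p * (q / p) ^ 2 + (1 - p) * ((1 - q) / (1 - p)) ^ 2 ≤ 1 + 16 / 3 * (q - p) ^ 2 := by
  obtain ⟨h0, h1⟩ := hp
  have hp0 : 0 < p := by linarith
  have hp1 : 0 < 1 - p := by linarith
  have heq : p * (q / p) ^ 2 + (1 - p) * ((1 - q) / (1 - p)) ^ 2 =
      1 + (q - p) ^ 2 / (p * (1 - p)) := by
    field_simp
    ring
  have hprod : 3 / 16 ≤ p * (1 - p) := by nlinarith
  rw [heq]
  gcongr
  rw [div_le_iff₀ (by positivity)]
  nlinarith [sq_nonneg (q - p)]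

lemma lintegral_likelihoodRatio_sq_le {F G : ℝ → ℝ} (hF : Measurable F) (hG : Measurable G)
    (hFb : ∀ w, F w ∈ Set.Icc (1 / 4 : ℝ) (3 / 4)) (hGb : ∀ w, G w ∈ Set.Icc (1 / 4 : ℝ) (3 / 4))
    {a b K : ℝ} (hab : a ≤ b) (hK : 0 ≤ K) (hin : ∀ w, (G w - F w) ^ 2 ≤ K)
    (hout : ∀ w, w ∉ Set.Icc a b → G w = F w) :
    ∫⁻ x, likelihoodRatio F G x ^ 2 ∂sampleLaw F ≤
      ENNReal.ofReal (1 + 8 / 3 * K * (b - a)) := by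
  rw [lintegral_sampleLaw hF ((measurable_likelihoodRatio hF hG).pow_const 2)]
  have hpt : ∀ w, ENNReal.ofReal (F w) * likelihoodRatio F G (w, true) ^ 2 +
      ENNReal.ofReal (1 - F w) * likelihoodRatio F G (w, false) ^ 2 ≤
      1 + (Set.Icc a b).indicator (fun _ => ENNReal.ofReal (16 / 3 * K)) w := by
    intro w
    obtain ⟨hF0, hF1⟩ := hFb w
    obtain ⟨hG0, hG1⟩ := hGb w
    have hp0 : 0 ≤ F w := by linarith
    have hp1 : 0 ≤ 1 - F w := by linarith
    have hq0 : 0 ≤ G w := by linarith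
    have hq1 : 0 ≤ 1 - G w := by linarith
    have hchi := bernoulli_chiSq_le (q := G w) (hFb w)
    simp only [likelihoodRatio, if_true, Bool.false_eq_true, if_false]
    rw [← ENNReal.ofReal_pow (by positivity), ← ENNReal.ofReal_pow (by positivity),
      ← ENNReal.ofReal_mul hp0, ← ENNReal.ofReal_mul hp1,
      ← ENNReal.ofReal_add (by positivity) (by positivity)]
    by_cases hw : w ∈ Set.Icc a b
    · rw [Set.indicator_of_mem hw, ← ENNReal.ofReal_one,
        ← ENNReal.ofReal_add zero_le_one (by positivity)]
      exact ENNReal.ofReal_le_ofReal (by linarith [hin w])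
    · rw [Set.indicator_of_notMem hw, add_zero, ← ENNReal.ofReal_one]
      rw [hout w hw, sub_self] at hchi
      rw [hout w hw]
      exact ENNReal.ofReal_le_ofReal (by linarith)
  calc _ ≤ 2⁻¹ * ∫⁻ w in Set.Icc (-1 : ℝ) 1,
        (1 + (Set.Icc a b).indicator (fun _ => ENNReal.ofReal (16 / 3 * K)) w) := by
        exact mul_le_mul_right (lintegral_mono hpt) _
    _ = 2⁻¹ * (2 + ∫⁻ w in Set.Icc (-1 : ℝ) 1,
        (Set.Icc a b).indicator (fun _ => ENNReal.ofReal (16 / 3 * K)) w) := by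
        rw [lintegral_add_left measurable_const, lintegral_one, Measure.restrict_apply_univ,
          Real.volume_Icc]
        norm_num
    _ ≤ 2⁻¹ * (2 + ∫⁻ w, (Set.Icc a b).indicator (fun _ => ENNReal.ofReal (16 / 3 * K)) w) := by
        gcongr
        exact Measure.restrict_le_self
    _ = ENNReal.ofReal (1 + 8 / 3 * K * (b - a)) := by
        have hba : 0 ≤ b - a := sub_nonneg.2 hab
        rw [lintegral_indicator measurableSet_Icc, setLIntegral_const, Real.volume_Icc,
          ← ENNReal.ofReal_mul (by positivity), ← ENNReal.ofReal_ofNat 2,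
          ← ENNReal.ofReal_add (by positivity) (by positivity),
          ← ENNReal.ofReal_inv_of_pos (by norm_num), ← ENNReal.ofReal_mul (by norm_num)]
        congr 1
        ring

lemma stepFn_mem_Icc {c : ℝ} (hc : 0 ≤ c) (t x : ℝ) :
    stepFn c t x ∈ Set.Icc (1 / 2 - c) (1 / 2 + c) := by
  unfold stepFn
  split_ifs <;> constructor <;> linarith

lemma intervalIntegrable_stepFn (c t a b : ℝ) :
    IntervalIntegrable (stepFn c t) volume a b := by
  have hmeas : Measurable (stepFn c t) :=
    Measurable.ite measurableSet_Iio measurable_const measurable_const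
  refine (intervalIntegrable_const (c := 1 / 2 + |c|)).mono_fun hmeas.aestronglyMeasurable ?_
  refine Filter.Eventually.of_forall fun x => ?_
  have h := abs_nonneg c
  have h' := le_abs_self c
  have h'' := neg_abs_le c
  simp only [Real.norm_eq_abs]
  rw [abs_of_nonneg (a := 1 / 2 + |c|) (by positivity)]
  unfold stepFn
  split_ifs <;> rw [abs_le] <;> constructor <;> linarith

lemma measurable_unifConv_stepFn (σ c t : ℝ) : Measurable (unifConv σ (stepFn c t)) := by
  have hint := intervalIntegrable_stepFn c t
  have hprim := (intervalIntegral.continuous_primitive hint 0).measurable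
  have heq : unifConv σ (stepFn c t) = fun w => (1 / (2 * σ)) *
      ((∫ x in (0 : ℝ)..(w + σ), stepFn c t x) - ∫ x in (0 : ℝ)..(w - σ), stepFn c t x) := by
    ext w
    rw [unifConv, intervalIntegral.integral_interval_sub_left (hint _ _) (hint _ _)]
  rw [heq]
  exact ((hprim.comp (measurable_id.add_const σ)).sub
    (hprim.comp (measurable_id.sub_const σ))).const_mul _

lemma unifConv_stepFn_mem_Icc {σ c : ℝ} (hσ : 0 < σ) (hc : 0 ≤ c) (t w : ℝ) :
    unifConv σ (stepFn c t) w ∈ Set.Icc (1 / 2 - c) (1 / 2 + c) := by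
  have hle : w - σ ≤ w + σ := by linarith
  have hlow := intervalIntegral.integral_mono_on hle intervalIntegrable_const
    (intervalIntegrable_stepFn c t _ _) fun x _ => (stepFn_mem_Icc hc t x).1
  have hupp := intervalIntegral.integral_mono_on hle (intervalIntegrable_stepFn c t _ _)
    intervalIntegrable_const fun x _ => (stepFn_mem_Icc hc t x).2
  rw [intervalIntegral.integral_const, smul_eq_mul] at hlow hupp
  rw [unifConv, one_div_mul_eq_div]
  constructor
  · rw [le_div_iff₀ (by positivity)]
    linarith
  · rw [div_le_iff₀ (by positivity)]
    linarith

lemma stepFn_zero_sub_stepFn {c δ : ℝ} (hδ : 0 ≤ δ) (x : ℝ) :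
    stepFn c 0 x - stepFn c δ x = (Set.Ico 0 δ).indicator (fun _ => 2 * c) x := by
  by_cases hx0 : x < 0
  · simp [stepFn, Set.indicator, hx0, hx0.trans_le hδ, hx0.not_ge]
  · by_cases hxδ : x < δ
    · simp [stepFn, Set.indicator, hx0, hxδ, not_lt.1 hx0]
      ring
    · simp [stepFn, Set.indicator, hx0, hxδ]

lemma unifConv_stepFn_zero_sub {σ c δ : ℝ} (hδ : 0 ≤ δ) (w : ℝ) :
    unifConv σ (stepFn c 0) w - unifConv σ (stepFn c δ) w = (1 / (2 * σ)) *
      ∫ x in (w - σ)..(w + σ), (Set.Ico 0 δ).indicator (fun _ => 2 * c) x := by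
  rw [unifConv, unifConv, ← mul_sub, ← intervalIntegral.integral_sub
    (intervalIntegrable_stepFn c 0 _ _) (intervalIntegrable_stepFn c δ _ _)]
  simp_rw [stepFn_zero_sub_stepFn hδ]

lemma unifConv_stepFn_sub_sq_le {σ c δ : ℝ} (hσ : 0 < σ) (hc : 0 ≤ c) (hδ : 0 ≤ δ) (w : ℝ) :
    (unifConv σ (stepFn c δ) w - unifConv σ (stepFn c 0) w) ^ 2 ≤ (c * δ / σ) ^ 2 := by
  have hnn : ∀ x, 0 ≤ (Set.Ico 0 δ).indicator (fun _ => 2 * c) x := fun x =>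
    Set.indicator_nonneg (fun _ _ => by positivity) x
  have hint : Integrable ((Set.Ico 0 δ).indicator fun _ => 2 * c) := by
    rw [integrable_indicator_iff measurableSet_Ico]
    exact integrableOn_const (by simp)
  have hle : w - σ ≤ w + σ := by linarith
  have h0 := intervalIntegral.integral_nonneg (μ := volume) hle fun x _ => hnn x
  have h1 : ∫ x in (w - σ)..(w + σ), (Set.Ico 0 δ).indicator (fun _ => 2 * c) x ≤
      δ * (2 * c) := by
    rw [intervalIntegral.integral_of_le hle]
    refine (setIntegral_le_integral hint (Filter.Eventually.of_forall hnn)).trans_eq ?_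
    rw [integral_indicator measurableSet_Ico, setIntegral_const]
    simp [hδ]
  rw [← neg_sub (unifConv σ (stepFn c 0) w), neg_sq, unifConv_stepFn_zero_sub hδ]
  refine pow_le_pow_left₀ (by positivity) ?_ 2
  calc _ ≤ (1 / (2 * σ)) * (δ * (2 * c)) := by gcongr
    _ = c * δ / σ := by field_simp

lemma unifConv_stepFn_eq {σ c δ : ℝ} (hσ : 0 < σ) (hδ : 0 ≤ δ) {w : ℝ}
    (hw : w ∉ Set.Icc (-σ) (σ + δ)) :
    unifConv σ (stepFn c δ) w = unifConv σ (stepFn c 0) w := by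
  have hzero : ∫ x in (w - σ)..(w + σ), (Set.Ico 0 δ).indicator (fun _ => 2 * c) x = 0 := by
    rw [intervalIntegral.integral_of_le (by linarith)]
    refine setIntegral_eq_zero_of_forall_eq_zero fun x hx => Set.indicator_of_notMem ?_ _
    rintro ⟨hx0, hxδ⟩
    exact hw ⟨by linarith [hx.2], by linarith [hx.1]⟩
  have h := unifConv_stepFn_zero_sub (σ := σ) (c := c) hδ w
  rw [hzero] at h
  linarith

/-- Le Cam's two-point bound for the absolute error under a second-moment bound on the
likelihood ratio. -/
lemma le_lintegral_add_lintegral_withDensity {Ω : Type*} [MeasurableSpace Ω] (P : Measure Ω)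
    {L : Ω → ℝ≥0∞} (hL : Measurable L) [IsProbabilityMeasure (P.withDensity L)]
    (hL2 : ∫⁻ x, L x ^ 2 ∂P ≤ 2) {T : Ω → ℝ} (hT : Measurable T) (s t : ℝ) :
    ENNReal.ofReal (|t - s| / 2) ≤ ∫⁻ x, ENNReal.ofReal |T x - s| ∂P +
      ∫⁻ x, ENNReal.ofReal |T x - t| ∂(P.withDensity L) := by
  set d := ENNReal.ofReal |t - s| with hd
  have hd' : ∀ x, d ≤ ENNReal.ofReal |T x - s| + ENNReal.ofReal |T x - t| := fun x => by
    rw [← ENNReal.ofReal_add (abs_nonneg _) (abs_nonneg _), hd, abs_sub_comm t s,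
      abs_sub_comm (T x) s]
    exact ENNReal.ofReal_le_ofReal (abs_sub_le s (T x) t)
  have hquad : ∀ l : ℝ≥0∞, l ≤ 1 + 4⁻¹ * l ^ 2 := by
    intro l
    induction l with
    | top => simp
    | coe l =>
      rw [← ENNReal.coe_ofNat, ← ENNReal.coe_inv (by norm_num)]
      norm_cast
      rw [← NNReal.coe_le_coe]
      push_cast
      nlinarith [sq_nonneg ((l : ℝ) - 2)]
  have hpt : ∀ x, d * L x ≤ ENNReal.ofReal |T x - s| +
      L x * ENNReal.ofReal |T x - t| + d * 4⁻¹ * L x ^ 2 := by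
    intro x
    rcases le_total (L x) 1 with hl | hl
    · refine le_trans ?_ le_self_add
      calc d * L x ≤ (ENNReal.ofReal |T x - s| + ENNReal.ofReal |T x - t|) * L x := by
            gcongr
            exact hd' x
        _ = ENNReal.ofReal |T x - s| * L x + L x * ENNReal.ofReal |T x - t| := by ring
        _ ≤ _ := by
            gcongr
            exact mul_le_of_le_one_right' hl
    · calc d * L x ≤ d * (1 + 4⁻¹ * L x ^ 2) := by
            gcongr
            exact hquad _
        _ = d + d * 4⁻¹ * L x ^ 2 := by ring
        _ ≤ _ := by
            gcongr
            refine (hd' x).trans ?_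
            gcongr
            exact le_mul_of_one_le_left' hl
  have hL1 : ∫⁻ x, L x ∂P = 1 := by
    rw [← setLIntegral_univ, ← withDensity_apply _ MeasurableSet.univ, measure_univ]
  have hs : Measurable fun x => ENNReal.ofReal |T x - s| := by fun_prop
  have ht : Measurable fun x => ENNReal.ofReal |T x - t| := by fun_prop
  have hhalf : d = ENNReal.ofReal (|t - s| / 2) + ENNReal.ofReal (|t - s| / 2) := by
    rw [← ENNReal.ofReal_add (by positivity) (by positivity), add_halves]
  have hquarter : d * 4⁻¹ * 2 = ENNReal.ofReal (|t - s| / 2) := by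
    rw [hd, ← ENNReal.ofReal_ofNat 4, ← ENNReal.ofReal_ofNat 2,
      ← ENNReal.ofReal_inv_of_pos (by norm_num), ← ENNReal.ofReal_mul (by positivity),
      ← ENNReal.ofReal_mul (by positivity)]
    congr 1
    ring
  have hmain : d ≤ ∫⁻ x, ENNReal.ofReal |T x - s| ∂P +
      ∫⁻ x, ENNReal.ofReal |T x - t| ∂(P.withDensity L) + ENNReal.ofReal (|t - s| / 2) := by
    calc d = ∫⁻ x, d * L x ∂P := by rw [lintegral_const_mul _ hL, hL1, mul_one]
      _ ≤ ∫⁻ x, (ENNReal.ofReal |T x - s| + L x * ENNReal.ofReal |T x - t| +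
          d * 4⁻¹ * L x ^ 2) ∂P := lintegral_mono hpt
      _ = ∫⁻ x, ENNReal.ofReal |T x - s| ∂P +
          ∫⁻ x, ENNReal.ofReal |T x - t| ∂(P.withDensity L) +
          d * 4⁻¹ * ∫⁻ x, L x ^ 2 ∂P := by
        rw [lintegral_add_left (by fun_prop), lintegral_add_left hs,
          lintegral_const_mul _ (hL.pow_const 2), lintegral_withDensity_eq_lintegral_mul _ hL ht]
        rfl
      _ ≤ _ := by
        rw [← hquarter]
        gcongr
  rw [hhalf] at hmain
  exact (ENNReal.add_le_add_iff_right ENNReal.ofReal_ne_top).1 hmain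

/-- Passive minimax lower bound, `k = 1`, large noise: for `κ₀/n ≤ σ ≤ 1/2`, every
estimator based on `n` i.i.d. passive samples has worst-case point error at least
`κ₁ √(σ/n)` over thresholds `t ∈ [-1/2, 1/2]`. -/
theorem passive_lower_bound_k_one_large_noise (c : ℝ) (hc : c ∈ Set.Ioc (0 : ℝ) (1 / 4)) :
    ∃ κ₀ κ₁ : ℝ, 1 ≤ κ₀ ∧ 0 < κ₁ ∧
      ∀ n : ℕ, 1 ≤ n → ∀ σ : ℝ, κ₀ / n ≤ σ → σ ≤ 1 / 2 →
        ∀ that : (Fin n → ℝ × Bool) → ℝ, Measurable that →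
          ENNReal.ofReal (κ₁ * Real.sqrt (σ / n)) ≤
            ⨆ t ∈ Set.Icc (-(1 : ℝ) / 2) (1 / 2),
              ∫⁻ x, ENNReal.ofReal |that x - t|
                ∂(Measure.pi fun _ : Fin n => sampleLaw (unifConv σ (stepFn c t))) := by
  refine ⟨1, 1 / 4, le_rfl, by norm_num, fun n hn σ hσn hσ that hthat => ?_⟩
  obtain ⟨hc0, hc1⟩ := hc
  have hn0 : (0 : ℝ) < n := by exact_mod_cast hn
  have hσ0 : 0 < σ := (by positivity : (0 : ℝ) < 1 / n).trans_le hσn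
  set δ := √(σ / n) with hδ
  have hδ0 : 0 ≤ δ := Real.sqrt_nonneg _
  have hδsq : δ ^ 2 = σ / n := Real.sq_sqrt (by positivity)
  have hδσ : δ ≤ σ := by
    refine Real.sqrt_le_iff.2 ⟨hσ0.le, ?_⟩
    rw [sq, div_eq_mul_one_div]
    gcongr
  set F := unifConv σ (stepFn c 0)
  set G := unifConv σ (stepFn c δ)
  have hF : Measurable F := measurable_unifConv_stepFn σ c 0
  have hG : Measurable G := measurable_unifConv_stepFn σ c δ
  have hsub : Set.Icc (1 / 2 - c) (1 / 2 + c) ⊆ Set.Icc (1 / 4) (3 / 4) :=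
    Set.Icc_subset_Icc (by linarith) (by linarith)
  have hFb : ∀ w, F w ∈ Set.Icc (1 / 4 : ℝ) (3 / 4) := fun w =>
    hsub (unifConv_stepFn_mem_Icc hσ0 hc0.le 0 w)
  have hGb : ∀ w, G w ∈ Set.Icc (1 / 4 : ℝ) (3 / 4) := fun w =>
    hsub (unifConv_stepFn_mem_Icc hσ0 hc0.le δ w)
  have hPF : IsProbabilityMeasure (sampleLaw F) := isProbabilityMeasure_sampleLaw hF
    (fun w => by linarith [(hFb w).1]) fun w => by linarith [(hFb w).2]
  have hPG : IsProbabilityMeasure (sampleLaw G) := isProbabilityMeasure_sampleLaw hG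
    (fun w => by linarith [(hGb w).1]) fun w => by linarith [(hGb w).2]
  have hr := measurable_likelihoodRatio hF hG
  have hdens := sampleLaw_eq_withDensity hF hG (fun w => by linarith [(hFb w).1])
    fun w => by linarith [(hFb w).2]
  have hPG' : IsProbabilityMeasure ((sampleLaw F).withDensity (likelihoodRatio F G)) :=
    hdens ▸ hPG
  have hpi : (Measure.pi fun _ : Fin n => sampleLaw G) =
      (Measure.pi fun _ : Fin n => sampleLaw F).withDensity
        fun x => ∏ i, likelihoodRatio F G (x i) := by
    rw [hdens]
    exact pi_withDensity _ hr
  have hsq : ∫⁻ x, likelihoodRatio F G x ^ 2 ∂sampleLaw F ≤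
      ENNReal.ofReal (Real.exp (1 / (2 * n))) := by
    refine (lintegral_likelihoodRatio_sq_le hF hG hFb hGb (by linarith) (sq_nonneg _)
      (unifConv_stepFn_sub_sq_le hσ0 hc0.le hδ0)
      fun w hw => unifConv_stepFn_eq hσ0 hδ0 hw).trans (ENNReal.ofReal_le_ofReal ?_)
    calc (1 : ℝ) + 8 / 3 * (c * δ / σ) ^ 2 * (σ + δ - -σ)
        ≤ (1 : ℝ) + 8 / 3 * (1 / 4 * δ / σ) ^ 2 * (3 * σ) := by
          gcongr
          · linarith
          · linarith
      _ = 1 / (2 * (n : ℝ)) + 1 := by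
        rw [div_pow, mul_pow, hδsq]
        field_simp
        ring
      _ ≤ _ := Real.add_one_le_exp _
  have hL : Measurable fun x : Fin n → ℝ × Bool => ∏ i, likelihoodRatio F G (x i) := by
    fun_prop
  have hL2 : ∫⁻ x, (∏ i, likelihoodRatio F G (x i)) ^ 2
      ∂(Measure.pi fun _ : Fin n => sampleLaw F) ≤ 2 := by
    simp_rw [← Finset.prod_pow]
    rw [lintegral_pi_prod _ fun _ => hr.pow_const 2, Finset.prod_const, Finset.card_univ,
      Fintype.card_fin]
    refine (pow_le_pow_left' hsq n).trans ?_
    rw [← ENNReal.ofReal_pow (Real.exp_nonneg _), ← Real.exp_nat_mul, ← ENNReal.ofReal_ofNat 2]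
    refine ENNReal.ofReal_le_ofReal ?_
    rw [show (n : ℝ) * (1 / (2 * n)) = 1 / 2 by field_simp]
    refine (Real.exp_one_rpow _).symm.trans_le ?_
    rw [← Real.sqrt_eq_rpow]
    exact Real.sqrt_le_iff.2 ⟨by norm_num, by linarith [Real.exp_one_lt_d9]⟩
  have hprob : IsProbabilityMeasure ((Measure.pi fun _ : Fin n => sampleLaw F).withDensity
      fun x => ∏ i, likelihoodRatio F G (x i)) := hpi ▸ inferInstance
  have hLeCam := le_lintegral_add_lintegral_withDensity _ hL hL2 hthat 0 δ
  rw [← hpi] at hLeCam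
  set S := ⨆ t ∈ Set.Icc (-(1 : ℝ) / 2) (1 / 2), ∫⁻ x, ENNReal.ofReal |that x - t|
    ∂(Measure.pi fun _ : Fin n => sampleLaw (unifConv σ (stepFn c t))) with hS
  have hS0 : ∫⁻ x, ENNReal.ofReal |that x - 0| ∂(Measure.pi fun _ : Fin n => sampleLaw F) ≤ S :=
    le_iSup₂_of_le (0 : ℝ) ⟨by norm_num, by norm_num⟩ le_rfl
  have hSδ : ∫⁻ x, ENNReal.ofReal |that x - δ| ∂(Measure.pi fun _ : Fin n => sampleLaw G) ≤ S :=
    le_iSup₂_of_le δ ⟨by linarith, by linarith⟩ le_rfl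
  have htwo : 2 * ENNReal.ofReal (1 / 4 * δ) ≤ 2 * S := by
    rw [← ENNReal.ofReal_ofNat 2, ← ENNReal.ofReal_mul (by norm_num), ENNReal.ofReal_ofNat,
      two_mul S]
    refine le_trans (le_of_eq ?_) (hLeCam.trans (add_le_add hS0 hSδ))
    rw [sub_zero, abs_of_nonneg hδ0]
    congr 1
    ring
  exact (ENNReal.mul_le_mul_iff_right (by norm_num) (by norm_num)).1 htwo
end
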